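/- arXiv:1306.0616 — 2 statements merged into one kernel-verified Lean document; each statement's English description precedes it below -/
import Mathlib

section
/- Let 𝒩₃⁽²⁾(N) denote the number of subsets S of {1,…,N³} with |S| = N, Σ_{i∈S} i = N(N³+1)/2, and Σ_{i∈S} i² = N(N³+1)(2N³+1)/6. Then, as N → ∞, 𝒩₃⁽²⁾(N) = (6√30/π^{3/2}) · (N²·e)^N / N^{21/2} · (1 − 1201/(980N) + o(1/N)); equivalently, (π^{3/2}/(6√30))·N^{21/2}·(N²·e)^{−N}·𝒩₃⁽²⁾(N) − (1 − 1201/(980N)) = o(1/N). -/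
open Filter Asymptotics

/-- The number of bimagic cube series of order `N`: subsets of `{1,…,N³}` with `N`
elements whose elements sum to `N(N³+1)/2` and whose squares sum to
`N(N³+1)(2N³+1)/6`. -/
def bimagicCubeSeries (N : ℕ) : ℕ :=
  ((Finset.Icc 1 (N ^ 3)).powerset.filter
    (fun S => S.card = N ∧ ∑ i ∈ S, i = N * (N ^ 3 + 1) / 2 ∧
      ∑ i ∈ S, i ^ 2 = N * (N ^ 3 + 1) * (2 * N ^ 3 + 1) / 6)).card

namespace BimagicCube

open scoped Topology Real
open MeasureTheory Set

theorem tendsto_nat_mul_exp_sub_one {x : ℕ → ℝ} {a : ℝ}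
    (h : Tendsto (fun n : ℕ => (n : ℝ) * x n) atTop (𝓝 a)) :
    Tendsto (fun n : ℕ => (n : ℝ) * (Real.exp (x n) - 1)) atTop (𝓝 a) := by
  have hinv : Tendsto (fun n : ℕ => ((n : ℝ))⁻¹) atTop (𝓝 0) := tendsto_inv_atTop_nhds_zero_nat
  have hx : Tendsto x atTop (𝓝 0) := by
    have := h.mul hinv
    rw [mul_zero] at this
    refine this.congr' ?_
    filter_upwards [eventually_gt_atTop 0] with n hn
    field_simp
  have hR : Tendsto (fun n : ℕ => (n : ℝ) * (Real.exp (x n) - 1 - x n)) atTop (𝓝 0) := by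
    have hb : Tendsto (fun n : ℕ => |(n : ℝ) * x n| * |x n|) atTop (𝓝 0) := by
      simpa using h.abs.mul hx.abs
    refine squeeze_zero_norm' ?_ hb
    have h1 : ∀ᶠ n in atTop, |x n| < 1 := by
      simpa using (tendsto_order.1 hx.abs).2 1 (by norm_num)
    filter_upwards [h1] with n hn
    rw [Real.norm_eq_abs, abs_mul, abs_mul, mul_assoc, ← sq, sq_abs]
    exact mul_le_mul_of_nonneg_left (Real.abs_exp_sub_one_sub_id_le hn.le) (abs_nonneg _)
  have := hR.add h
  rw [zero_add] at this
  refine this.congr fun n => ?_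
  ring

theorem log_stirlingSeq_sub_le {n : ℕ} (hn : n ≠ 0) :
    Real.log (Stirling.stirlingSeq n) - 1 / (12 * n) ≤ Real.log √π := by
  have hlim : Tendsto (fun k : ℕ => Real.log (Stirling.stirlingSeq (k + 1)) -
      1 / (12 * ((k + 1 : ℕ) : ℝ))) atTop (𝓝 (Real.log √π - 0)) := by
    refine Tendsto.sub ?_ ?_
    · exact ((Real.continuousAt_log (by positivity)).tendsto.comp
        Stirling.tendsto_stirlingSeq_sqrt_pi).comp (tendsto_add_atTop_nat 1)
    · have : Tendsto (fun k : ℕ => 1 / (12 * (k : ℝ))) atTop (𝓝 0) := by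
        have := (tendsto_inv_atTop_nhds_zero_nat (𝕜 := ℝ)).const_mul (1 / 12)
        rw [mul_zero] at this
        refine this.congr fun k => ?_
        rw [one_div, one_div, mul_inv]
      exact this.comp (tendsto_add_atTop_nat 1)
  have hmono : Monotone (fun k : ℕ => Real.log (Stirling.stirlingSeq (k + 1)) -
      1 / (12 * ((k + 1 : ℕ) : ℝ))) := by
    refine monotone_nat_of_le_succ fun k => ?_
    have := Stirling.log_stirlingSeq_sdiff_le (k + 1)
    have e : 1 / (12 * ((k + 1 : ℕ) : ℝ)) - 1 / (12 * ((k + 1 + 1 : ℕ) : ℝ)) =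
        1 / (12 * ((k + 1 : ℕ) : ℝ) * (((k + 1 : ℕ) : ℝ) + 1)) := by
      push_cast
      field_simp
      ring
    linarith
  obtain ⟨k, rfl⟩ := Nat.exists_eq_succ_of_ne_zero hn
  have := hmono.ge_of_tendsto hlim k
  rw [sub_zero] at this
  exact this

theorem le_log_stirlingSeq_sub {n : ℕ} (hn : n ≠ 0) :
    Real.log √π ≤ Real.log (Stirling.stirlingSeq n) - 1 / (12 * (n + 1)) := by
  have hlim : Tendsto (fun k : ℕ => Real.log (Stirling.stirlingSeq (k + 1)) -
      1 / (12 * ((k + 1 : ℕ) + 1 : ℝ))) atTop (𝓝 (Real.log √π - 0)) := by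
    refine Tendsto.sub ?_ ?_
    · exact ((Real.continuousAt_log (by positivity)).tendsto.comp
        Stirling.tendsto_stirlingSeq_sqrt_pi).comp (tendsto_add_atTop_nat 1)
    · have : Tendsto (fun k : ℕ => 1 / (12 * (k : ℝ))) atTop (𝓝 0) := by
        have := (tendsto_inv_atTop_nhds_zero_nat (𝕜 := ℝ)).const_mul (1 / 12)
        rw [mul_zero] at this
        refine this.congr fun k => ?_
        rw [one_div, one_div, mul_inv]
      refine (this.comp (tendsto_add_atTop_nat 2)).congr fun k => ?_
      simp only [Function.comp]
      push_cast
      ring_nf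
  have hanti : Antitone (fun k : ℕ => Real.log (Stirling.stirlingSeq (k + 1)) -
      1 / (12 * ((k + 1 : ℕ) + 1 : ℝ))) := by
    refine antitone_nat_of_succ_le fun k => ?_
    have h1 := (Stirling.log_stirlingSeq_sdiff_hasSum k).summable.le_tsum 0
      (fun j _ => by positivity)
    rw [(Stirling.log_stirlingSeq_sdiff_hasSum k).tsum_eq] at h1
    have e : 1 / (12 * ((k + 1 : ℕ) + 1 : ℝ)) - 1 / (12 * ((k + 1 + 1 : ℕ) + 1 : ℝ)) ≤
        (1 : ℝ) / (2 * ((0 + 1 : ℕ) : ℝ) + 1) *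
          ((1 / (2 * ((k + 1 : ℕ) : ℝ) + 1)) ^ 2) ^ (0 + 1) := by
      push_cast
      rw [div_sub_div _ _ (by positivity) (by positivity), pow_one, div_pow,
        div_mul_div_comm, div_le_div_iff₀ (by positivity) (by positivity)]
      have : (0 : ℝ) ≤ k := k.cast_nonneg
      nlinarith [mul_nonneg this this]
    linarith
  obtain ⟨k, rfl⟩ := Nat.exists_eq_succ_of_ne_zero hn
  have := hanti.le_of_tendsto hlim k
  rw [sub_zero] at this
  exact this

/-- Stirling's formula with its first correction term. -/
theorem tendsto_stirling_ratio :
    Tendsto (fun n : ℕ => (n : ℝ) *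
      (√(2 * π * n) * (n / Real.exp 1) ^ n / (n.factorial : ℝ) - 1)) atTop (𝓝 (-(1 / 12))) := by
  have hx : Tendsto (fun n : ℕ => (n : ℝ) *
      (Real.log √π - Real.log (Stirling.stirlingSeq n))) atTop (𝓝 (-(1 / 12))) := by
    have hl : Tendsto (fun n : ℕ => -(1 / 12 : ℝ)) atTop (𝓝 (-(1 / 12))) := tendsto_const_nhds
    have hu : Tendsto (fun n : ℕ => -(1 / 12 : ℝ) * ((n : ℝ) / (n + 1))) atTop
        (𝓝 (-(1 / 12))) := by
      have := (tendsto_natCast_div_add_atTop (𝕜 := ℝ) 1).const_mul (-(1 / 12 : ℝ))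
      rwa [mul_one] at this
    refine tendsto_of_tendsto_of_tendsto_of_le_of_le' hl hu ?_ ?_
    · filter_upwards [eventually_ne_atTop 0] with n hn
      have h := log_stirlingSeq_sub_le hn
      have hn' : (0 : ℝ) < n := by exact_mod_cast Nat.pos_of_ne_zero hn
      calc -(1 / 12 : ℝ) = n * (-(1 / (12 * n))) := by field_simp
        _ ≤ _ := mul_le_mul_of_nonneg_left (by linarith) hn'.le
    · filter_upwards [eventually_ne_atTop 0] with n hn
      have h := le_log_stirlingSeq_sub hn
      have hn' : (0 : ℝ) < n := by exact_mod_cast Nat.pos_of_ne_zero hn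
      calc _ ≤ n * (-(1 / (12 * ((n : ℝ) + 1)))) :=
            mul_le_mul_of_nonneg_left (by linarith) hn'.le
        _ = _ := by field_simp
  refine (tendsto_nat_mul_exp_sub_one hx).congr' ?_
  filter_upwards [eventually_ne_atTop 0] with n hn
  have hn' : (0 : ℝ) < n := by exact_mod_cast Nat.pos_of_ne_zero hn
  have hs : 0 < Stirling.stirlingSeq n := by
    unfold Stirling.stirlingSeq
    positivity
  rw [Real.exp_sub, Real.exp_log (by positivity), Real.exp_log hs, Stirling.stirlingSeq]
  congr 2
  rw [show (2 * π * n : ℝ) = π * (2 * n) by ring, Real.sqrt_mul Real.pi_pos.le]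
  field_simp

/-- The points `(2k + 1 - M) / M`, `0 ≤ k < M`, equally spaced in `[-1, 1]`. -/
noncomputable def node (M k : ℕ) : ℝ := (2 * k + 1 - M) / M

/-- The centered square of a node. -/
noncomputable def nodeSq (M k : ℕ) : ℝ := node M k ^ 2 - (1 - 1 / (M : ℝ) ^ 2) / 3

/-- The linear form in the centered first and second powers of a node. -/
noncomputable def phase (M : ℕ) (p : ℝ × ℝ) (k : ℕ) : ℝ := p.1 * node M k + p.2 * nodeSq M k

/-- The character `exp (i (u x + v (x² - m)))` at the node `x`. -/
noncomputable def chi (M : ℕ) (p : ℝ × ℝ) (k : ℕ) : ℂ := Complex.exp (Complex.I * phase M p k)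

/-- The characteristic function of the pair (node, centered square of the node). -/
noncomputable def charFn (M : ℕ) (p : ℝ × ℝ) : ℂ := (∑ k ∈ Finset.range M, chi M p k) / M

/-- A period cell for the pair (node sum, square sum). -/
def cell (M : ℕ) : Set (ℝ × ℝ) :=
  Ioc (-(π * M / 2)) (π * M / 2) ×ˢ Ioc (-(π * (M : ℝ) ^ 2 / 8)) (π * (M : ℝ) ^ 2 / 8)

/-- Tuples of nodes whose first and second power sums have their mean values. -/
def IsBalanced {N M : ℕ} (f : Fin N → Fin M) : Prop :=
  ∑ j, node M (f j) = 0 ∧ ∑ j, nodeSq M (f j) = 0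

theorem norm_chi (M : ℕ) (p : ℝ × ℝ) (k : ℕ) : ‖chi M p k‖ = 1 := by
  rw [chi, mul_comm, Complex.norm_exp_ofReal_mul_I]

theorem continuous_chi (M k : ℕ) : Continuous fun p => chi M p k := by
  unfold chi phase
  fun_prop

theorem continuous_charFn (M : ℕ) : Continuous (charFn M) := by
  unfold charFn
  exact (continuous_finsetSum _ fun k _ => continuous_chi M k).div_const _

theorem sum_chi {M : ℕ} (hM : M ≠ 0) (p : ℝ × ℝ) :
    ∑ k : Fin M, chi M p k = M * charFn M p := by
  rw [charFn, Fin.sum_univ_eq_sum_range (fun k => chi M p k)]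
  field_simp

theorem norm_charFn_le_one (M : ℕ) (p : ℝ × ℝ) : ‖charFn M p‖ ≤ 1 := by
  rw [charFn, norm_div, Complex.norm_natCast]
  refine div_le_one_of_le₀ ?_ (by positivity)
  refine (norm_sum_le _ _).trans ?_
  simp [norm_chi]

theorem integral_exp_int {c : ℝ} (hc : 0 < c) (n : ℤ) :
    ∫ t in Ioc (-c) c, Complex.exp (Complex.I * (t * (π * n / c) : ℝ)) =
      if n = 0 then (2 * c : ℂ) else 0 := by
  rw [← intervalIntegral.integral_of_le (by linarith)]
  split_ifs with h
  · subst h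
    simp
    ring
  · have hn : (n : ℂ) ≠ 0 := by exact_mod_cast h
    have hc' : (c : ℂ) ≠ 0 := by exact_mod_cast hc.ne'
    have hpi : (π : ℂ) ≠ 0 := by exact_mod_cast Real.pi_ne_zero
    have h0 : (Complex.I * (π * n / c) : ℂ) ≠ 0 := by
      simp [hn, hc']
    have e : ∀ t : ℝ, Complex.exp (Complex.I * (t * (π * n / c) : ℝ)) =
        Complex.exp ((Complex.I * (π * n / c) : ℂ) * t) := by
      intro t
      congr 1
      push_cast
      ring
    simp_rw [e]
    rw [integral_exp_mul_complex h0]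
    have e1 : (Complex.I * (π * n / c) : ℂ) * (c : ℝ) = -(n * (π * Complex.I)) + n * (2 * π * Complex.I) := by
      field_simp
      ring
    have e2 : (Complex.I * (π * n / c) : ℂ) * ((-c : ℝ) : ℂ) = -(n * (π * Complex.I)) := by
      push_cast
      field_simp
    rw [e1, e2, Complex.exp_add, Complex.exp_int_mul_two_pi_mul_I]
    simp

theorem mean_targets (N : ℕ) :
    2 * ((N * (N ^ 3 + 1) / 2 : ℕ) : ℤ) = N * (N ^ 3 + 1) ∧
    6 * ((N * (N ^ 3 + 1) * (2 * N ^ 3 + 1) / 6 : ℕ) : ℤ) = N * (N ^ 3 + 1) * (2 * N ^ 3 + 1) := by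
  have h2 : 2 ∣ N * (N ^ 3 + 1) := by
    rw [← Nat.modEq_zero_iff_dvd]
    have : N % 2 < 2 := Nat.mod_lt _ (by norm_num)
    have h : N ≡ N % 2 [MOD 2] := (Nat.mod_modEq _ _).symm
    refine (h.mul ((h.pow 3).add_right 1)).trans ?_
    interval_cases N % 2 <;> decide
  have h6 : 6 ∣ N * (N ^ 3 + 1) * (2 * N ^ 3 + 1) := by
    rw [← Nat.modEq_zero_iff_dvd]
    have : N % 6 < 6 := Nat.mod_lt _ (by norm_num)
    have h : N ≡ N % 6 [MOD 6] := (Nat.mod_modEq _ _).symm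
    refine ((h.mul ((h.pow 3).add_right 1)).mul (((h.pow 3).mul_left 2).add_right 1)).trans ?_
    interval_cases N % 6 <;> decide
  constructor
  · exact_mod_cast Nat.mul_div_cancel' h2
  · exact_mod_cast Nat.mul_div_cancel' h6

theorem sum_node_eq {N : ℕ} (f : Fin N → Fin (N ^ 3)) :
    ∑ j, node (N ^ 3) (f j) = 2 / (N : ℝ) ^ 3 *
      (((∑ j, ((f j : ℕ) + 1) : ℕ) : ℤ) - ((N * (N ^ 3 + 1) / 2 : ℕ) : ℤ) : ℤ) := by
  have h := (mean_targets N).1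
  generalize N * (N ^ 3 + 1) / 2 = T at h ⊢
  have h' : 2 * (T : ℝ) = N * (N ^ 3 + 1) := by exact_mod_cast h
  rcases Nat.eq_zero_or_pos N with rfl | hN
  · simp
  have hN' : (N : ℝ) ≠ 0 := by positivity
  have e : ∑ j, node (N ^ 3) (f j) =
      1 / (N : ℝ) ^ 3 * (2 * ∑ j, (((f j : ℕ) : ℝ) + 1) - N * (N ^ 3 + 1)) := by
    simp_rw [node]
    rw [← Finset.sum_div]
    simp only [Finset.sum_add_distrib, Finset.sum_sub_distrib, ← Finset.mul_sum]
    simp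
    field_simp
    ring
  rw [e, ← h']
  push_cast
  ring

theorem sum_nodeSq_eq {N : ℕ} (f : Fin N → Fin (N ^ 3)) (h0 : ∑ j, node (N ^ 3) (f j) = 0) :
    ∑ j, nodeSq (N ^ 3) (f j) = 4 / (N : ℝ) ^ 6 *
      (((∑ j, ((f j : ℕ) + 1) ^ 2 : ℕ) : ℤ) -
        ((N * (N ^ 3 + 1) * (2 * N ^ 3 + 1) / 6 : ℕ) : ℤ) : ℤ) := by
  have h := (mean_targets N).2
  generalize N * (N ^ 3 + 1) * (2 * N ^ 3 + 1) / 6 = T at h ⊢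
  have h' : 6 * (T : ℝ) =
    N * (N ^ 3 + 1) * (2 * N ^ 3 + 1) := by exact_mod_cast h
  rcases Nat.eq_zero_or_pos N with rfl | hN
  · simp
  have hN' : (N : ℝ) ≠ 0 := by positivity
  have e : ∀ k : ℕ, nodeSq (N ^ 3) k = 4 / (N : ℝ) ^ 6 * (k + 1) ^ 2
      - 2 * (N ^ 3 + 1) / N ^ 3 * node (N ^ 3) k
      - ((N ^ 3 + 1) * (2 * N ^ 3 + 1) * (2 / 3) / N ^ 6) := by
    intro k
    rw [nodeSq, node]
    push_cast
    field_simp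
    ring
  simp_rw [e]
  rw [Finset.sum_sub_distrib, Finset.sum_sub_distrib, ← Finset.mul_sum, ← Finset.mul_sum, h0]
  push_cast
  simp
  have : (T : ℝ) = N * (N ^ 3 + 1) * (2 * N ^ 3 + 1) / 6 := by linarith
  rw [this]
  field_simp
  ring

theorem even_sum_sq_sub {N : ℕ} (f : Fin N → Fin (N ^ 3)) (h0 : ∑ j, node (N ^ 3) (f j) = 0) :
    ∃ B : ℤ, ∑ j, nodeSq (N ^ 3) (f j) = 8 / (N : ℝ) ^ 6 * B := by
  rcases Nat.eq_zero_or_pos N with rfl | hN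
  · exact ⟨0, by simp⟩
  have hA : ((∑ j, ((f j : ℕ) + 1) : ℕ) : ℤ) = ((N * (N ^ 3 + 1) / 2 : ℕ) : ℤ) := by
    have := sum_node_eq f
    rw [h0] at this
    have hN' : (2 / (N : ℝ) ^ 3) ≠ 0 := by positivity
    have := (mul_eq_zero.1 this.symm).resolve_left hN'
    have := Int.cast_eq_zero.1 this
    omega
  obtain ⟨h1, h2⟩ := mean_targets N
  rw [sum_nodeSq_eq f h0]
  set T₁ := ((N * (N ^ 3 + 1) / 2 : ℕ) : ℤ)
  set T₂ := ((N * (N ^ 3 + 1) * (2 * N ^ 3 + 1) / 6 : ℕ) : ℤ)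
  have hT : (2 : ℤ) ∣ T₂ - T₁ := by
    have : 3 * T₂ = T₁ * (2 * N ^ 3 + 1) := by
      have : 2 * (3 * T₂) = 2 * (T₁ * (2 * N ^ 3 + 1)) := by
        rw [← mul_assoc 2 T₁, h1]
        linarith
      linarith
    exact ⟨T₁ * N ^ 3 - T₂, by linarith⟩
  have hS : (2 : ℤ) ∣ ((∑ j, ((f j : ℕ) + 1) ^ 2 : ℕ) : ℤ) - ((∑ j, ((f j : ℕ) + 1) : ℕ) : ℤ) := by
    push_cast
    rw [← Finset.sum_sub_distrib]
    refine Finset.dvd_sum fun j _ => ?_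
    have := Int.even_mul_succ_self (f j : ℤ)
    rw [even_iff_two_dvd] at this
    convert! this using 1
    ring
  rw [hA] at hS
  obtain ⟨B, hB⟩ := (dvd_sub hS hT)
  refine ⟨B, ?_⟩
  have : ((∑ j, ((f j : ℕ) + 1) ^ 2 : ℕ) : ℤ) - T₂ = 2 * B := by linarith
  rw [this]
  push_cast
  ring

open scoped Classical in
theorem integral_prod_chi {N : ℕ} (hN : N ≠ 0) (f : Fin N → Fin (N ^ 3)) :
    ∫ p in cell (N ^ 3), ∏ j, chi (N ^ 3) p (f j) =
      if IsBalanced f then (π ^ 2 * (N : ℂ) ^ 9 / 4) else 0 := by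
  have hN0 : (0 : ℝ) < N := by exact_mod_cast Nat.pos_of_ne_zero hN
  set X := ∑ j, node (N ^ 3) (f j) with hX
  set Z := ∑ j, nodeSq (N ^ 3) (f j) with hZ
  have e : ∀ p : ℝ × ℝ, ∏ j, chi (N ^ 3) p (f j) =
      Complex.exp (Complex.I * (p.1 * X : ℝ)) * Complex.exp (Complex.I * (p.2 * Z : ℝ)) := by
    intro p
    simp_rw [chi]
    rw [← Complex.exp_sum, ← Complex.exp_add, hX, hZ, Finset.mul_sum, Finset.mul_sum]
    congr 1
    rw [← mul_add, ← Complex.ofReal_add, ← Finset.sum_add_distrib, ← Finset.mul_sum]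
    simp_rw [phase]
    push_cast
    rfl
  simp_rw [e]
  rw [cell, Measure.volume_eq_prod,
    setIntegral_prod_mul (fun u : ℝ => Complex.exp (Complex.I * (u * X : ℝ)))
      (fun v : ℝ => Complex.exp (Complex.I * (v * Z : ℝ)))]
  have hc1 : 0 < π * (N ^ 3 : ℕ) / 2 := by push_cast; positivity
  have hc2 : 0 < π * ((N ^ 3 : ℕ) : ℝ) ^ 2 / 8 := by push_cast; positivity
  set A : ℤ := ((∑ j, ((f j : ℕ) + 1) : ℕ) : ℤ) - ((N * (N ^ 3 + 1) / 2 : ℕ) : ℤ) with hA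
  have hXA : X = π * A / (π * (N ^ 3 : ℕ) / 2) := by
    rw [hX, sum_node_eq f, ← hA]
    push_cast
    field_simp
  by_cases hA0 : A = 0
  · have hX0 : X = 0 := by rw [hXA, hA0]; simp
    obtain ⟨B, hB⟩ := even_sum_sq_sub f hX0
    have hZB : Z = π * B / (π * ((N ^ 3 : ℕ) : ℝ) ^ 2 / 8) := by
      rw [hZ, hB]
      push_cast
      field_simp
    have hb : IsBalanced f ↔ B = 0 := by
      rw [IsBalanced, ← hX, hB]
      simp [hX0, hN]
    rw [hXA, hZB, integral_exp_int hc1, integral_exp_int hc2, if_pos hA0]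
    simp only [hb]
    split_ifs with h
    · push_cast
      ring
    · simp
  · have hb : ¬ IsBalanced f := by
      rintro ⟨h, -⟩
      rw [← hX, hXA] at h
      have : (A : ℝ) ≠ 0 := by exact_mod_cast hA0
      have := Real.pi_ne_zero
      simp_all
    rw [if_neg hb, hXA, integral_exp_int hc1, if_neg hA0, zero_mul]

section Tuples

theorem sum_filter_restrict_prod {α κ : Type*} [Fintype α] [Fintype κ] [DecidableEq α] (z : κ → ℂ)
    (s : Finset α) (P : (s → κ) → Prop) [DecidablePred P] :
    ∑ f : α → κ with P (fun x => f x), ∏ j, z (f j) =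
      (∑ g with P g, ∏ x, z (g x)) * (∑ k, z k) ^ (Fintype.card α - s.card) := by
  rw [Finset.sum_filter, Finset.sum_filter,
    ← (Equiv.piEquivPiSubtypeProd (· ∈ s) (fun _ => κ)).symm.sum_comp, Fintype.sum_prod_type,
    Finset.sum_mul]
  refine Finset.sum_congr rfl fun g _ => ?_
  have hg : ∀ h : {x // x ∉ s} → κ, (fun x : s =>
      (Equiv.piEquivPiSubtypeProd (· ∈ s) (fun _ => κ)).symm (g, h) x) = g := by
    intro h
    ext x
    simp [Equiv.piEquivPiSubtypeProd]
  simp_rw [hg]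
  split_ifs with hP
  · have hp : ∀ h : {x // x ∉ s} → κ,
        ∏ j, z ((Equiv.piEquivPiSubtypeProd (· ∈ s) (fun _ => κ)).symm (g, h) j) =
          (∏ x, z (g x)) * ∏ y, z (h y) := by
      intro h
      rw [← Fintype.prod_subtype_mul_prod_subtype (· ∈ s)]
      congr 1
      · refine Finset.prod_congr (by ext; simp) fun x _ => ?_
        simp [Equiv.piEquivPiSubtypeProd]
      · refine Finset.prod_congr rfl fun x _ => ?_
        simp [Equiv.piEquivPiSubtypeProd, x.2]
    simp_rw [hp]
    rw [← Finset.mul_sum]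
    congr 1
    have := (Finset.prod_univ_sum (fun _ : {x // x ∉ s} => (Finset.univ : Finset κ))
      (fun _ k => z k)).symm
    rw [Fintype.piFinset_univ] at this
    rw [this, Finset.prod_const, Finset.card_univ]
    congr 1
    rw [Fintype.card_subtype_compl]
    simp
  · simp

theorem sum_filter_eq_prod {α κ : Type*} [Fintype α] [Fintype κ] [DecidableEq α]
    [DecidableEq κ] (z : κ → ℂ)
    {i j : α} (hij : i ≠ j) :
    ∑ f : α → κ with f i = f j, ∏ l, z (f l) =
      (∑ k, z k ^ 2) * (∑ k, z k) ^ (Fintype.card α - 2) := by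
  have h := sum_filter_restrict_prod z {i, j}
    (fun g => g ⟨i, by simp⟩ = g ⟨j, by simp⟩)
  rw [Finset.card_pair hij] at h
  rw [h]
  congr 1
  have hmem : ∀ x : ({i, j} : Finset α), x = ⟨i, by simp⟩ ∨ x = ⟨j, by simp⟩ := by
    rintro ⟨x, hx⟩
    simpa using hx
  refine Finset.sum_bij' (fun g _ => g ⟨i, by simp⟩) (fun k _ => fun _ => k) ?_ ?_ ?_ ?_ ?_
  · simp
  · simp
  · intro g hg
    ext x
    rcases hmem x with rfl | rfl
    · rfl
    · exact (Finset.mem_filter.1 hg).2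
  · simp
  · intro g hg
    have hg' := (Finset.mem_filter.1 hg).2
    have : ∀ x, z (g x) = z (g ⟨i, by simp⟩) := by
      intro x
      rcases hmem x with rfl | rfl
      · rfl
      · rw [hg']
    rw [Finset.prod_congr rfl fun x _ => this x, Finset.prod_const, Finset.card_univ,
      Fintype.card_coe, Finset.card_pair hij]

theorem card_le_of_determined {α κ : Type*} [Fintype α] [Fintype κ] [DecidableEq α] {d e : α} (hde : d ≠ e)
    (S : Finset (α → κ))
    (hS : ∀ g ∈ S, ∀ g' ∈ S, (∀ x, x ≠ d → x ≠ e → g x = g' x) → g = g') :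
    S.card ≤ Fintype.card κ ^ (Fintype.card α - 2) := by
  have hinj : Set.InjOn (fun (g : α → κ) (x : {x // x ∉ ({d, e} : Finset α)}) => g x) S := by
    intro g hg g' hg' h
    refine hS g hg g' hg' fun x hxd hxe => ?_
    exact congrFun h ⟨x, by simp [hxd, hxe]⟩
  have := Finset.card_le_card_of_injOn (t := Finset.univ) _ (fun _ _ => Finset.mem_coe.2 (Finset.mem_univ _)) hinj
  refine this.trans (le_of_eq ?_)
  rw [Finset.card_univ, Fintype.card_fun, Fintype.card_subtype_compl, Fintype.card_coe,
    Finset.card_pair hde]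

theorem norm_sum_filter_eq_eq_prod_le {α κ : Type*} [Fintype α] [Fintype κ] [LinearOrder α]
    [DecidableEq κ]
    (z : κ → ℂ) (hz : ∀ k, ‖z k‖ = 1) {i j k l : α} (hij : i < j) (hkl : k < l)
    (h : (i, j) ≠ (k, l)) :
    ∃ m, 3 ≤ m ∧ m ≤ 4 ∧ m ≤ Fintype.card α ∧
    ‖∑ f : α → κ with f i = f j ∧ f k = f l, ∏ x, z (f x)‖ ≤
      (Fintype.card κ : ℝ) ^ (m - 2) * ‖∑ k, z k‖ ^ (Fintype.card α - m) := by
  set s : Finset α := {i, j, k, l} with hs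
  have hi : i ∈ s := by simp [hs]
  have hj : j ∈ s := by simp [hs]
  have hk : k ∈ s := by simp [hs]
  have hl : l ∈ s := by simp [hs]
  refine ⟨s.card, ?_, Finset.card_le_four, Finset.card_le_univ s, ?_⟩
  · by_cases hjl : j = l
    · have hik : i ≠ k := fun e => h (by rw [e, hjl])
      have : ({i, j, k} : Finset α) ⊆ s := by
        intro x
        simp only [hs, Finset.mem_insert, Finset.mem_singleton]
        tauto
      rw [← Finset.card_eq_three.2 ⟨i, j, k, hij.ne, hik, (hjl ▸ hkl).ne', rfl⟩]
      exact Finset.card_le_card this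
    · by_cases hil : i = l
      · have : ({k, i, j} : Finset α) ⊆ s := by
          intro x
          simp only [hs, Finset.mem_insert, Finset.mem_singleton]
          tauto
        rw [← Finset.card_eq_three.2 ⟨k, i, j, (hil ▸ hkl).ne, ((hil ▸ hkl).trans hij).ne, hij.ne, rfl⟩]
        exact Finset.card_le_card this
      · have : ({i, j, l} : Finset α) ⊆ s := by
          intro x
          simp only [hs, Finset.mem_insert, Finset.mem_singleton]
          tauto
        rw [← Finset.card_eq_three.2 ⟨i, j, l, hij.ne, hil, hjl, rfl⟩]
        exact Finset.card_le_card this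
  · have e := sum_filter_restrict_prod z s
      (fun g => g ⟨i, hi⟩ = g ⟨j, hj⟩ ∧ g ⟨k, hk⟩ = g ⟨l, hl⟩)
    rw [e, norm_mul, norm_pow]
    refine mul_le_mul_of_nonneg_right ?_ (by positivity)
    refine (norm_sum_le _ _).trans ?_
    simp only [norm_prod, hz, Finset.prod_const_one, Finset.sum_const, nsmul_eq_mul, mul_one]
    have hc : s.card = Fintype.card s := (Fintype.card_coe s).symm
    rw [hc]
    norm_cast
    by_cases hjl : j = l
    · have hik : i ≠ k := fun e => h (by rw [e, hjl])
      refine card_le_of_determined (d := ⟨i, hi⟩) (e := ⟨k, hk⟩) (by simpa using hik) _ ?_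
      intro g hg g' hg' hx
      obtain ⟨-, hg1, hg2⟩ := Finset.mem_filter.1 hg
      obtain ⟨-, hg1', hg2'⟩ := Finset.mem_filter.1 hg'
      have h1 : g ⟨j, hj⟩ = g' ⟨j, hj⟩ :=
        hx _ (by simpa using hij.ne') (by simpa using (hjl ▸ hkl).ne')
      have h2 : g ⟨l, hl⟩ = g' ⟨l, hl⟩ := by
        have : (⟨l, hl⟩ : s) = ⟨j, hj⟩ := by simp [hjl]
        rw [this, h1]
      ext x
      by_cases hxi : x = ⟨i, hi⟩
      · rw [hxi, hg1, hg1', h1]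
      by_cases hxk : x = ⟨k, hk⟩
      · rw [hxk, hg2, hg2', h2]
      exact hx x hxi hxk
    · refine card_le_of_determined (d := ⟨j, hj⟩) (e := ⟨l, hl⟩) (by simpa using hjl) _ ?_
      intro g hg g' hg' hx
      obtain ⟨-, hg1, hg2⟩ := Finset.mem_filter.1 hg
      obtain ⟨-, hg1', hg2'⟩ := Finset.mem_filter.1 hg'
      have hboth : g ⟨j, hj⟩ = g' ⟨j, hj⟩ ∧ g ⟨l, hl⟩ = g' ⟨l, hl⟩ := by
        by_cases hil : i = l
        · have hkk : g ⟨k, hk⟩ = g' ⟨k, hk⟩ :=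
            hx _ (by simpa using ((hil ▸ hkl).trans hij).ne) (by simpa using hkl.ne)
          have h2 : g ⟨l, hl⟩ = g' ⟨l, hl⟩ := by rw [← hg2, ← hg2', hkk]
          have h3 : (⟨i, hi⟩ : s) = ⟨l, hl⟩ := by simp [hil]
          exact ⟨by rw [← hg1, ← hg1', h3, h2], h2⟩
        · have hii : g ⟨i, hi⟩ = g' ⟨i, hi⟩ :=
            hx _ (by simpa using hij.ne) (by simpa using hil)
          have h2 : g ⟨j, hj⟩ = g' ⟨j, hj⟩ := by rw [← hg1, ← hg1', hii]
          refine ⟨h2, ?_⟩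
          by_cases hkj : k = j
          · have h3 : (⟨k, hk⟩ : s) = ⟨j, hj⟩ := by simp [hkj]
            rw [← hg2, ← hg2', h3, h2]
          · rw [← hg2, ← hg2', hx _ (by simpa using hkj) (by simpa using hkl.ne)]
      ext x
      by_cases hxi : x = ⟨j, hj⟩
      · rw [hxi, hboth.1]
      by_cases hxk : x = ⟨l, hl⟩
      · rw [hxk, hboth.2]
      exact hx x hxi hxk

end Tuples

theorem continuous_integrableOn_cell {E : Type*} [NormedAddCommGroup E] {f : ℝ × ℝ → E}
    (hf : Continuous f) (M : ℕ) : IntegrableOn f (cell M) := by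
  refine (hf.continuousOn.integrableOn_compact (isCompact_Icc.prod isCompact_Icc)).mono_set
    (prod_mono Ioc_subset_Icc_self Ioc_subset_Icc_self)

section Counts

open scoped Classical

theorem card_filter_balanced {N : ℕ} (hN : N ≠ 0) (F : Finset (Fin N → Fin (N ^ 3))) :
    ((F.filter IsBalanced).card : ℂ) * (π ^ 2 * (N : ℂ) ^ 9 / 4) =
      ∫ p in cell (N ^ 3), ∑ f ∈ F, ∏ j, chi (N ^ 3) p (f j) := by
  rw [integral_finsetSum]
  · simp_rw [integral_prod_chi hN]
    rw [← Finset.sum_filter, Finset.sum_const, nsmul_eq_mul]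
  · intro f _
    exact continuous_integrableOn_cell (continuous_finsetProd _ fun j _ => continuous_chi _ _) _

theorem card_balanced {N : ℕ} (hN : N ≠ 0) :
    ((Finset.univ.filter (IsBalanced (N := N) (M := N ^ 3))).card : ℂ) *
        (π ^ 2 * (N : ℂ) ^ 9 / 4) =
      ((N : ℂ) ^ 3) ^ N * ∫ p in cell (N ^ 3), charFn (N ^ 3) p ^ N := by
  rw [card_filter_balanced hN, ← integral_const_mul]
  congr 1
  ext p
  rw [← Fintype.sum_pow (fun k : Fin (N ^ 3) => chi (N ^ 3) p k), sum_chi (pow_ne_zero 3 hN), mul_pow]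
  push_cast
  rfl

theorem card_balanced_eq {N : ℕ} {i j : Fin N} (hij : i ≠ j) :
    (((Finset.univ.filter (fun f : Fin N → Fin (N ^ 3) => f i = f j)).filter IsBalanced).card : ℂ) *
        (π ^ 2 * (N : ℂ) ^ 9 / 4) =
      ((N : ℂ) ^ 3) ^ (N - 1) * ∫ p in cell (N ^ 3),
        charFn (N ^ 3) ((2 : ℝ) • p) * charFn (N ^ 3) p ^ (N - 2) := by
  have h2 : 2 ≤ N := by
    have := i.2
    have := j.2
    have : (i : ℕ) ≠ j := fun h => hij (Fin.ext h)
    omega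
  have hN : N ≠ 0 := by omega
  rw [card_filter_balanced hN, ← integral_const_mul]
  congr 1
  ext p
  rw [sum_filter_eq_prod (fun k : Fin (N ^ 3) => chi (N ^ 3) p k) hij, sum_chi (pow_ne_zero 3 hN), mul_pow, Fintype.card_fin]
  have : ∀ k, chi (N ^ 3) p k ^ 2 = chi (N ^ 3) ((2 : ℝ) • p) k := by
    intro k
    rw [chi, chi, ← Complex.exp_nat_mul]
    congr 1
    simp [phase]
    ring
  simp_rw [this]
  rw [sum_chi (pow_ne_zero 3 hN)]
  push_cast
  rw [show N - 1 = (N - 2) + 1 by omega, pow_succ ((N : ℂ) ^ 3)]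
  ring

theorem card_balanced_eq_eq_le {N : ℕ} {i j k l : Fin N} (hij : i < j) (hkl : k < l)
    (h : (i, j) ≠ (k, l)) :
    (((Finset.univ.filter (fun f : Fin N → Fin (N ^ 3) => f i = f j ∧ f k = f l)).filter
        IsBalanced).card : ℝ) * (π ^ 2 * (N : ℝ) ^ 9 / 4) ≤
      ((N : ℝ) ^ 3) ^ (N - 2) * ∫ p in cell (N ^ 3), ‖charFn (N ^ 3) p‖ ^ (N - 4) := by
  have hN : N ≠ 0 := by
    have := i.2
    omega
  have e := card_filter_balanced hN
    (Finset.univ.filter (fun f : Fin N → Fin (N ^ 3) => f i = f j ∧ f k = f l))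
  have e' := congrArg norm e
  rw [norm_mul, Complex.norm_natCast] at e'
  have hK : ‖(π ^ 2 * (N : ℂ) ^ 9 / 4)‖ = π ^ 2 * (N : ℝ) ^ 9 / 4 := by
    simp [abs_of_pos Real.pi_pos]
  rw [hK] at e'
  rw [e', ← integral_const_mul]
  refine (norm_integral_le_integral_norm _).trans ?_
  refine integral_mono ?_ ?_ ?_
  · refine (continuous_integrableOn_cell (continuous_finsetSum _ fun f _ =>
      continuous_finsetProd _ fun j _ => continuous_chi _ _) _).norm
  · exact continuous_integrableOn_cell
      (continuous_const.mul ((continuous_charFn _).norm.pow _)) _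
  · intro p
    obtain ⟨m, hm3, hm4, hmN, hle⟩ := norm_sum_filter_eq_eq_prod_le
      (fun k : Fin (N ^ 3) => chi (N ^ 3) p k) (fun k => norm_chi _ _ _) hij hkl h
    refine le_trans hle ?_
    rw [sum_chi (pow_ne_zero 3 hN), Fintype.card_fin, Fintype.card_fin] at *
    rw [norm_mul, mul_pow, ← mul_assoc]
    have hn : ‖((N ^ 3 : ℕ) : ℂ)‖ = (N : ℝ) ^ 3 := by
      rw [Complex.norm_natCast]
      push_cast
      rfl
    rw [hn]
    push_cast
    rw [← pow_add, show m - 2 + (N - m) = N - 2 by omega]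
    refine mul_le_mul_of_nonneg_left ?_ (by positivity)
    exact pow_le_pow_of_le_one (norm_nonneg _) (norm_charFn_le_one _ _) (by omega)

end Counts

theorem isBalanced_iff {N : ℕ} (hN : N ≠ 0) (f : Fin N → Fin (N ^ 3)) :
    IsBalanced f ↔ ∑ j, ((f j : ℕ) + 1) = N * (N ^ 3 + 1) / 2 ∧
      ∑ j, ((f j : ℕ) + 1) ^ 2 = N * (N ^ 3 + 1) * (2 * N ^ 3 + 1) / 6 := by
  have h1 : ∑ j, node (N ^ 3) (f j) = 0 ↔ ∑ j, ((f j : ℕ) + 1) = N * (N ^ 3 + 1) / 2 := by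
    rw [sum_node_eq]
    generalize ∑ j, ((f j : ℕ) + 1) = a
    generalize N * (N ^ 3 + 1) / 2 = b
    rw [mul_eq_zero, or_iff_right (by positivity), Int.cast_eq_zero]
    omega
  have h2 : ∑ j, node (N ^ 3) (f j) = 0 → (∑ j, nodeSq (N ^ 3) (f j) = 0 ↔
      ∑ j, ((f j : ℕ) + 1) ^ 2 = N * (N ^ 3 + 1) * (2 * N ^ 3 + 1) / 6) := by
    intro h
    rw [sum_nodeSq_eq f h]
    generalize ∑ j, ((f j : ℕ) + 1) ^ 2 = a
    generalize N * (N ^ 3 + 1) * (2 * N ^ 3 + 1) / 6 = b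
    rw [mul_eq_zero, or_iff_right (by positivity), Int.cast_eq_zero]
    omega
  rw [IsBalanced, ← h1]
  exact and_congr_right h2

open scoped Classical in
theorem card_balanced_injective {N : ℕ} (hN : N ≠ 0) :
    (Finset.univ.filter (fun f : Fin N → Fin (N ^ 3) => IsBalanced f ∧ f.Injective)).card =
      bimagicCubeSeries N * N.factorial := by
  set t := (Finset.Icc 1 (N ^ 3)).powerset.filter
    (fun S => S.card = N ∧ ∑ i ∈ S, i = N * (N ^ 3 + 1) / 2 ∧
      ∑ i ∈ S, i ^ 2 = N * (N ^ 3 + 1) * (2 * N ^ 3 + 1) / 6) with ht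
  have hcard : bimagicCubeSeries N = t.card := by
    rw [bimagicCubeSeries]
  let φ : (Fin N → Fin (N ^ 3)) → Finset ℕ := fun f => Finset.univ.image fun j => (f j : ℕ) + 1
  have hsum : ∀ f : Fin N → Fin (N ^ 3), f.Injective → (φ f).card = N ∧
      ∑ i ∈ φ f, i = ∑ j, ((f j : ℕ) + 1) ∧ ∑ i ∈ φ f, i ^ 2 = ∑ j, ((f j : ℕ) + 1) ^ 2 := by
    intro f hf
    have hinj : Function.Injective fun j => (f j : ℕ) + 1 := fun a b h =>
      hf (Fin.ext (Nat.succ_injective h))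
    refine ⟨?_, ?_, ?_⟩
    · rw [Finset.card_image_of_injective _ hinj, Finset.card_univ, Fintype.card_fin]
    · rw [Finset.sum_image hinj.injOn]
    · rw [Finset.sum_image hinj.injOn]
  rw [Finset.card_eq_sum_card_fiberwise (f := φ) (t := t), hcard]
  · rw [← smul_eq_mul, ← Finset.sum_const]
    refine Finset.sum_congr rfl fun S hS => ?_
    obtain ⟨hS1, hS2, hS3, hS4⟩ := Finset.mem_filter.1 hS
    rw [Finset.mem_powerset] at hS1
    have hfac : Fintype.card (Fin N ≃ S) = N.factorial := by
      rw [Fintype.card_equiv (Fintype.equivOfCardEq (by simp [hS2])), Fintype.card_fin]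
    rw [← hfac, ← Finset.card_univ]
    symm
    have hlt : ∀ x : S, (x : ℕ) - 1 < N ^ 3 := fun x => by
      have := Finset.mem_Icc.1 (hS1 x.2)
      omega
    have hsub : ∀ x : S, (x : ℕ) - 1 + 1 = x := fun x => by
      have := Finset.mem_Icc.1 (hS1 x.2)
      omega
    refine Finset.card_bij (fun e _ => fun j => ⟨(e j : ℕ) - 1, hlt (e j)⟩) ?_ ?_ ?_
    · intro e _
      have hinj : Function.Injective fun j => (⟨(e j : ℕ) - 1, hlt (e j)⟩ : Fin (N ^ 3)) := by
        intro a b hab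
        have := congrArg (fun x : Fin (N ^ 3) => (x : ℕ) + 1) hab
        simp only [hsub] at this
        exact e.injective (Subtype.ext this)
      have himg : φ (fun j => ⟨(e j : ℕ) - 1, hlt (e j)⟩) = S := by
        ext x
        simp only [φ, Finset.mem_image, Finset.mem_univ, true_and, hsub]
        constructor
        · rintro ⟨j, rfl⟩
          exact (e j).2
        · intro hx
          exact ⟨e.symm ⟨x, hx⟩, by simp⟩
      obtain ⟨-, h2, h3⟩ := hsum _ hinj
      simp only [Finset.mem_filter, Finset.mem_univ, true_and]
      refine ⟨⟨?_, hinj⟩, himg⟩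
      rw [isBalanced_iff hN, ← h2, ← h3, himg]
      exact ⟨hS3, hS4⟩
    · intro e _ e' _ h
      ext j
      have := congrArg (fun x : Fin (N ^ 3) => (x : ℕ) + 1) (congrFun h j)
      simpa only [hsub] using this
    · intro f hf
      simp only [Finset.mem_filter, Finset.mem_univ, true_and] at hf
      obtain ⟨⟨-, hinj⟩, himg⟩ := hf
      have hmem : ∀ j, (f j : ℕ) + 1 ∈ S := fun j => by
        rw [← himg]
        exact Finset.mem_image_of_mem _ (Finset.mem_univ j)
      have hbij : Function.Bijective (fun j => (⟨(f j : ℕ) + 1, hmem j⟩ : S)) := by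
        constructor
        · intro a b hab
          have := congrArg (fun x : S => (x : ℕ)) hab
          exact hinj (Fin.ext (Nat.succ_injective this))
        · rintro ⟨x, hx⟩
          rw [← himg] at hx
          obtain ⟨j, -, hj⟩ := Finset.mem_image.1 hx
          exact ⟨j, Subtype.ext hj⟩
      exact ⟨Equiv.ofBijective _ hbij, Finset.mem_univ _, by ext j; simp⟩
  · intro f hf
    simp only [Finset.coe_filter, Finset.mem_univ, true_and, Set.mem_ofPred_eq] at hf
    obtain ⟨hb, hinj⟩ := hf
    obtain ⟨h1, h2, h3⟩ := hsum f hinj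
    rw [isBalanced_iff hN] at hb
    simp only [ht, Finset.coe_filter, Finset.mem_powerset, Set.mem_ofPred_eq]
    refine ⟨?_, h1, h2 ▸ hb.1, h3 ▸ hb.2⟩
    intro x hx
    obtain ⟨j, -, rfl⟩ := Finset.mem_image.1 hx
    have := (f j).2
    rw [Finset.mem_Icc]
    omega

/-- The pairs `i < j` of indices. -/
def indexPairs (N : ℕ) : Finset (Fin N × Fin N) := Finset.univ.filter fun q => q.1 < q.2

theorem card_indexPairs (N : ℕ) : (indexPairs N).card = N.choose 2 := by
  have h := Finset.card_powersetCard 2 (Finset.univ : Finset (Fin N))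
  rw [Finset.card_univ, Fintype.card_fin] at h
  rw [← h]
  refine Finset.card_bij (fun q _ => {q.1, q.2}) ?_ ?_ ?_
  · intro q hq
    rw [Finset.mem_powersetCard]
    exact ⟨Finset.subset_univ _, Finset.card_pair (Finset.mem_filter.1 hq).2.ne⟩
  · rintro ⟨a, b⟩ hq ⟨c, d⟩ hq' h
    have h1 := (Finset.mem_filter.1 hq).2
    have h2 := (Finset.mem_filter.1 hq').2
    simp only [Finset.ext_iff, Finset.mem_insert, Finset.mem_singleton] at h
    have ha := (h a).1 (Or.inl rfl)
    have hb := (h b).1 (Or.inr rfl)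
    have hc := (h c).2 (Or.inl rfl)
    have hd := (h d).2 (Or.inr rfl)
    simp only at h1 h2
    ext <;> simp only <;> omega
  · intro s hs
    obtain ⟨-, hs⟩ := Finset.mem_powersetCard.1 hs
    obtain ⟨a, b, hab, rfl⟩ := Finset.card_eq_two.1 hs
    rcases lt_or_gt_of_ne hab with h | h
    · exact ⟨(a, b), by simp [indexPairs, h], rfl⟩
    · exact ⟨(b, a), by simp [indexPairs, h], Finset.pair_comm _ _⟩

/-- Bonferroni's inequalities for the number of injective functions in a set. -/
theorem abs_card_injective_sub_le {N : ℕ} {κ : Type*} [DecidableEq κ]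
    (U : Finset (Fin N → κ)) [DecidablePred fun f : Fin N → κ => f.Injective] :
    |((U.filter fun f => f.Injective).card : ℝ) - U.card +
        ∑ q ∈ indexPairs N, ((U.filter fun f => f q.1 = f q.2).card : ℝ)| ≤
      ∑ r ∈ (indexPairs N).offDiag,
        ((U.filter fun f => f r.1.1 = f r.1.2 ∧ f r.2.1 = f r.2.2).card : ℝ) := by
  let c : (Fin N → κ) → Finset (Fin N × Fin N) := fun f =>
    (indexPairs N).filter fun q => f q.1 = f q.2
  have h0 : ((U.filter fun f => f.Injective).card : ℝ) =
      ∑ f ∈ U, if f.Injective then (1 : ℝ) else 0 := by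
    rw [← Finset.sum_filter]
    simp
  have h1 : ∑ q ∈ indexPairs N, ((U.filter fun f => f q.1 = f q.2).card : ℝ) =
      ∑ f ∈ U, ((c f).card : ℝ) := by
    simp only [c, Finset.card_filter]
    push_cast
    exact Finset.sum_comm
  have h2 : ∑ r ∈ (indexPairs N).offDiag,
        ((U.filter fun f => f r.1.1 = f r.1.2 ∧ f r.2.1 = f r.2.2).card : ℝ) =
      ∑ f ∈ U, ((c f).offDiag.card : ℝ) := by
    have : ∀ f, (c f).offDiag = (indexPairs N).offDiag.filter
        fun r => f r.1.1 = f r.1.2 ∧ f r.2.1 = f r.2.2 := by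
      intro f
      ext ⟨a, b⟩
      simp only [c, Finset.mem_offDiag, Finset.mem_filter]
      tauto
    simp only [this, Finset.card_filter]
    push_cast
    exact Finset.sum_comm
  rw [h0, h1, h2, Finset.card_eq_sum_ones]
  push_cast
  rw [← Finset.sum_sub_distrib, ← Finset.sum_add_distrib]
  refine (Finset.abs_sum_le_sum_abs _ _).trans (Finset.sum_le_sum fun f _ => ?_)
  have hoff : ((c f).offDiag.card : ℝ) = (c f).card * (c f).card - (c f).card := by
    rw [Finset.offDiag_card, Nat.cast_sub (Nat.le_mul_self _)]
    push_cast
    rfl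
  have hinj : f.Injective ↔ (c f).card = 0 := by
    rw [Finset.card_eq_zero, Finset.filter_eq_empty_iff]
    constructor
    · intro hf q hq h
      exact (Finset.mem_filter.1 hq).2.ne (hf h)
    · intro h a b hab
      by_contra hne
      rcases lt_or_gt_of_ne hne with h' | h'
      · exact h (x := (a, b)) (by simp [indexPairs, h']) hab
      · exact h (x := (b, a)) (by simp [indexPairs, h']) hab.symm
  rw [hoff]
  rcases Nat.eq_zero_or_pos (c f).card with h | h
  · rw [if_pos (hinj.2 h), h]
    norm_num
  · rw [if_neg (fun hf => by have := hinj.1 hf; omega)]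
    have : (1 : ℝ) ≤ (c f).card := by exact_mod_cast h
    rw [abs_le]
    constructor <;> nlinarith [sq_nonneg (((c f).card : ℝ) - 1)]

theorem le_of_abs_sin_le {s : ℕ → ℝ} {τ : ℝ} (hτ : τ ≤ 1 / 2) (h0 : ∀ h, 0 ≤ s h)
    (h1 : s 1 ≤ π) (hs : ∀ h, 1 ≤ h → s (h + 1) ≤ 4 * s h) {H : ℕ}
    (hb : ∀ h, 1 ≤ h → h ≤ H → |2 * Real.sin (s h / 2)| ≤ τ) :
    ∀ h, 1 ≤ h → h ≤ H → s h ≤ π / 2 * τ := by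
  have key : ∀ h, 1 ≤ h → h ≤ H → s h ≤ π → s h ≤ π / 2 * τ := by
    intro h hh hH hp
    have e1 := Real.mul_le_sin (x := s h / 2) (by linarith [h0 h]) (by linarith)
    have e2 := (le_abs_self _).trans (hb h hh hH)
    have e3 : 2 / π * (s h / 2) = s h / π := by field_simp
    rw [e3] at e1
    have e4 : s h / π ≤ τ / 2 := by linarith
    rw [div_le_iff₀ Real.pi_pos] at e4
    linarith
  intro h hh
  induction h, hh using Nat.le_induction with
  | base => exact fun hH => key 1 le_rfl hH h1
  | succ h hh ih =>
    intro hH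
    refine key _ (by omega) hH ?_
    have := ih (by omega)
    have := hs h hh
    nlinarith [Real.pi_pos]

theorem abs_two_mul_sin_eq (x : ℝ) :
    |2 * Real.sin (x / 2)| = ‖Complex.exp (Complex.I * x) - 1‖ := by
  rw [Complex.norm_exp_I_mul_ofReal_sub_one, Real.norm_eq_abs]

theorem abs_two_mul_sin_abs (x : ℝ) : |2 * Real.sin (|x| / 2)| = |2 * Real.sin (x / 2)| := by
  rcases abs_cases x with ⟨h, -⟩ | ⟨h, -⟩
  · rw [h]
  · rw [h, neg_div, Real.sin_neg, mul_neg, abs_neg]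

theorem norm_exp_second_difference_le {ω : ℂ} (hω : ‖ω‖ = 1) (a b c : ℝ) :
    ‖Complex.exp (Complex.I * (a - 2 * b + c : ℝ)) - 1‖ ≤
      ‖ω * Complex.exp (Complex.I * a) - 1‖ + 2 * ‖ω * Complex.exp (Complex.I * b) - 1‖ +
        ‖ω * Complex.exp (Complex.I * c) - 1‖ := by
  have hn : ∀ x : ℝ, ‖ω * Complex.exp (Complex.I * x)‖ = 1 := by
    intro x
    rw [norm_mul, hω, mul_comm Complex.I, Complex.norm_exp_ofReal_mul_I, one_mul]
  set α := ω * Complex.exp (Complex.I * a) with hα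
  set β := ω * Complex.exp (Complex.I * b) with hβ
  set γ := ω * Complex.exp (Complex.I * c) with hγ
  have e : β ^ 2 * (Complex.exp (Complex.I * (a - 2 * b + c : ℝ)) - 1) =
      (α - 1) * γ + (γ - 1) - (β - 1) * β - (β - 1) := by
    have : β ^ 2 * Complex.exp (Complex.I * (a - 2 * b + c : ℝ)) = α * γ := by
      rw [hα, hβ, hγ, mul_pow, ← Complex.exp_nat_mul, mul_assoc, ← Complex.exp_add,
        mul_mul_mul_comm, ← Complex.exp_add, sq]
      congr 2
      push_cast
      ring
    rw [mul_sub, this]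
    ring
  have hβ1 : ‖β‖ = 1 := hn b
  have hγ1 : ‖γ‖ = 1 := hn c
  calc ‖Complex.exp (Complex.I * (a - 2 * b + c : ℝ)) - 1‖
      = ‖β ^ 2 * (Complex.exp (Complex.I * (a - 2 * b + c : ℝ)) - 1)‖ := by
        rw [norm_mul, norm_pow, hβ1, one_pow, one_mul]
    _ = ‖(α - 1) * γ + (γ - 1) - (β - 1) * β - (β - 1)‖ := by rw [e]
    _ ≤ ‖(α - 1) * γ‖ + ‖γ - 1‖ + ‖(β - 1) * β‖ + ‖β - 1‖ := by
        refine (norm_sub_le _ _).trans (add_le_add_left ?_ _)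
        refine (norm_sub_le _ _).trans (add_le_add_left ?_ _)
        exact norm_add_le _ _
    _ = _ := by
        rw [norm_mul (α - 1) γ, norm_mul (β - 1) β, hβ1, hγ1]
        ring

theorem norm_exp_difference_le {ω : ℂ} (hω : ‖ω‖ = 1) (a b : ℝ) :
    ‖Complex.exp (Complex.I * (b - a : ℝ)) - 1‖ ≤
      ‖ω * Complex.exp (Complex.I * a) - 1‖ + ‖ω * Complex.exp (Complex.I * b) - 1‖ := by
  have hn : ‖ω * Complex.exp (Complex.I * a)‖ = 1 := by
    rw [norm_mul, hω, mul_comm Complex.I, Complex.norm_exp_ofReal_mul_I, one_mul]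
  have e : ω * Complex.exp (Complex.I * a) * (Complex.exp (Complex.I * (b - a : ℝ)) - 1) =
      (ω * Complex.exp (Complex.I * b) - 1) - (ω * Complex.exp (Complex.I * a) - 1) := by
    rw [mul_sub, mul_assoc, ← Complex.exp_add,
      show Complex.I * a + Complex.I * (b - a : ℝ) = Complex.I * b by push_cast; ring]
    ring
  calc ‖Complex.exp (Complex.I * (b - a : ℝ)) - 1‖
      = ‖ω * Complex.exp (Complex.I * a) * (Complex.exp (Complex.I * (b - a : ℝ)) - 1)‖ := by
        rw [norm_mul, hn, one_mul]
    _ ≤ _ := by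
        rw [e, add_comm]
        exact norm_sub_le _ _

theorem sum_range_shift_le {d : ℕ → ℝ} (hd : ∀ k, 0 ≤ d k) {n h M : ℕ} (hnh : n + h ≤ M) :
    ∑ k ∈ Finset.range n, d (k + h) ≤ ∑ k ∈ Finset.range M, d k := by
  rw [Finset.range_eq_Ico, Finset.sum_Ico_add', Finset.range_eq_Ico]
  exact Finset.sum_le_sum_of_subset_of_nonneg
    (Finset.Ico_subset_Ico (by omega) hnh) fun k _ _ => hd k

theorem exists_rotation (M : ℕ) (p : ℝ × ℝ) (hM : M ≠ 0) :
    ∃ ω : ℂ, ‖ω‖ = 1 ∧ ∑ k ∈ Finset.range M, ‖ω * chi M p k - 1‖ ≤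
      M * √(2 * (1 - ‖charFn M p‖)) := by
  obtain ⟨ω, hω, hωS⟩ : ∃ ω : ℂ, ‖ω‖ = 1 ∧ ω * charFn M p = ‖charFn M p‖ := by
    by_cases h : charFn M p = 0
    · exact ⟨1, by simp, by simp [h]⟩
    · have hn : (‖charFn M p‖ : ℂ) ≠ 0 := by simpa using h
      refine ⟨(starRingEnd ℂ) (charFn M p) / ‖charFn M p‖, ?_, ?_⟩
      · rw [norm_div, Complex.norm_conj, Complex.norm_real, norm_norm, div_self (by simpa using h)]
      · rw [div_mul_eq_mul_div, Complex.conj_mul', sq, mul_div_assoc, div_self hn, mul_one]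
  refine ⟨ω, hω, ?_⟩
  have hM' : (0 : ℝ) < M := by exact_mod_cast Nat.pos_of_ne_zero hM
  have hd : ∀ k, ‖ω * chi M p k - 1‖ ^ 2 = 2 - 2 * (ω * chi M p k).re := by
    intro k
    have h1 : ‖ω * chi M p k‖ = 1 := by rw [norm_mul, hω, norm_chi, one_mul]
    have h2 : (ω * chi M p k).re * (ω * chi M p k).re +
        (ω * chi M p k).im * (ω * chi M p k).im = 1 := by
      rw [← Complex.normSq_apply, Complex.normSq_eq_norm_sq, h1, one_pow]
    rw [← Complex.normSq_eq_norm_sq, Complex.normSq_apply, Complex.sub_re, Complex.sub_im,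
      Complex.one_re, Complex.one_im]
    linarith
  have hs : ∑ k ∈ Finset.range M, ‖ω * chi M p k - 1‖ ^ 2 = M * (2 * (1 - ‖charFn M p‖)) := by
    simp_rw [hd]
    rw [Finset.sum_sub_distrib, ← Finset.mul_sum, ← Complex.re_sum, ← Finset.mul_sum]
    have : ω * ∑ k ∈ Finset.range M, chi M p k = (M * ‖charFn M p‖ : ℝ) := by
      have e : ∑ k ∈ Finset.range M, chi M p k = M * charFn M p := by
        rw [charFn]
        field_simp
      rw [e, mul_left_comm, hωS]
      push_cast
      rfl
    rw [this, Complex.ofReal_re]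
    simp
    ring
  have hcs := sq_sum_le_card_mul_sum_sq (s := Finset.range M)
    (f := fun k => ‖ω * chi M p k - 1‖)
  rw [hs, Finset.card_range] at hcs
  have : ∑ k ∈ Finset.range M, ‖ω * chi M p k - 1‖ ≤
      √((M : ℝ) * (M * (2 * (1 - ‖charFn M p‖)))) := Real.le_sqrt_of_sq_le hcs
  refine this.trans (le_of_eq ?_)
  rw [← mul_assoc, Real.sqrt_mul (by positivity), Real.sqrt_mul_self hM'.le]

theorem card_mul_le_of_le {M n : ℕ} {A B : ℝ} {d : ℕ → ℝ} (h : ∀ k, k < n → A ≤ d k)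
    (hB : ∑ k ∈ Finset.range n, d k ≤ B) (hn : (M : ℝ) ≤ 2 * n) (hA : 0 ≤ A) :
    M * A ≤ 2 * B := by
  have h1 := Finset.card_nsmul_le_sum (Finset.range n) d A
    (fun k hk => h k (Finset.mem_range.1 hk))
  rw [Finset.card_range, nsmul_eq_mul] at h1
  nlinarith

theorem sq_add_sq_le {M : ℕ} (hM : 4 ≤ M) {p : ℝ × ℝ} (h1 : |p.1| ≤ π * M / 2)
    (h2 : |p.2| ≤ π * (M : ℝ) ^ 2 / 8) {τ : ℝ} (hτ : √(2 * (1 - ‖charFn M p‖)) ≤ τ)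
    (hτ1 : τ ≤ 1 / 1000) : |p.1| ≤ 1500 * τ ∧ |p.2| ≤ 110 * τ := by
  have hM0 : (0 : ℝ) < M := by exact_mod_cast (by omega : 0 < M)
  have hτ0 : 0 ≤ τ := (Real.sqrt_nonneg _).trans hτ
  obtain ⟨ω, hω, hsum⟩ := exists_rotation M p (by omega)
  have hpi := Real.pi_gt_three
  have hpi' := Real.pi_lt_d2
  set d : ℕ → ℝ := fun k => ‖ω * chi M p k - 1‖ with hd
  have hd0 : ∀ k, 0 ≤ d k := fun k => norm_nonneg _
  have hD : ∑ k ∈ Finset.range M, d k ≤ M * τ :=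
    hsum.trans (mul_le_mul_of_nonneg_left hτ hM0.le)
  set H := M / 4 with hH
  have hH1 : 1 ≤ H := by omega
  have hH4 : 4 * H ≤ M := by omega
  have hH8 : (M : ℝ) ≤ 8 * H := by exact_mod_cast (by omega : M ≤ 8 * H)
  have hsecond : ∀ h : ℕ, 1 ≤ h → h ≤ H →
      |2 * Real.sin ((|8 * p.2 / (M : ℝ) ^ 2| * (h : ℝ) ^ 2) / 2)| ≤ 8 * τ := by
    intro h hh1 hhH
    have e0 : |8 * p.2 / (M : ℝ) ^ 2| * (h : ℝ) ^ 2 = |8 * p.2 / (M : ℝ) ^ 2 * (h : ℝ) ^ 2| := by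
      rw [abs_mul, abs_of_nonneg (sq_nonneg (h : ℝ))]
    rw [e0, abs_two_mul_sin_abs, abs_two_mul_sin_eq]
    have hdiff : ∀ k : ℕ, 8 * p.2 / (M : ℝ) ^ 2 * (h : ℝ) ^ 2 =
        phase M p k - 2 * phase M p (k + h) + phase M p (k + 2 * h) := by
      intro k
      simp only [phase, node, nodeSq]
      push_cast
      field_simp
      ring
    have := card_mul_le_of_le (M := M) (n := M - 2 * h)
      (d := fun k => d k + 2 * d (k + h) + d (k + 2 * h))
      (A := ‖Complex.exp (Complex.I * (8 * p.2 / (M : ℝ) ^ 2 * (h : ℝ) ^ 2 : ℝ)) - 1‖)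
      (B := M * τ + 2 * (M * τ) + M * τ) ?_ ?_ ?_ (norm_nonneg _)
    · have h' : M * ‖Complex.exp (Complex.I * (8 * p.2 / (M : ℝ) ^ 2 * (h : ℝ) ^ 2 : ℝ)) - 1‖ ≤
          M * (8 * τ) := by linarith
      exact le_of_mul_le_mul_left h' hM0
    · intro k _
      rw [hdiff k]
      exact norm_exp_second_difference_le hω _ _ _
    · rw [Finset.sum_add_distrib, Finset.sum_add_distrib, ← Finset.mul_sum]
      have a0 := sum_range_shift_le hd0 (n := M - 2 * h) (h := 0) (M := M) (by omega)
      have a1 := sum_range_shift_le hd0 (n := M - 2 * h) (h := h) (M := M) (by omega)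
      have a2 := sum_range_shift_le hd0 (n := M - 2 * h) (h := 2 * h) (M := M) (by omega)
      simp only [add_zero] at a0
      linarith
    · exact_mod_cast (by omega : M ≤ 2 * (M - 2 * h))
  have hv := le_of_abs_sin_le (s := fun h => |8 * p.2 / (M : ℝ) ^ 2| * (h : ℝ) ^ 2)
    (τ := 8 * τ) (by linarith) (fun h => by positivity) ?_ ?_ hsecond H hH1 le_rfl
  rotate_left
  · rw [abs_div, abs_mul, abs_of_pos (by positivity : (0 : ℝ) < (M : ℝ) ^ 2),
      abs_of_pos (by norm_num : (0 : ℝ) < 8), Nat.cast_one, one_pow, mul_one,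
      div_le_iff₀ (by positivity)]
    linarith
  · intro h hh
    have hh' : (1 : ℝ) ≤ h := by exact_mod_cast hh
    have : ((h + 1 : ℕ) : ℝ) ^ 2 ≤ 4 * (h : ℝ) ^ 2 := by
      push_cast
      nlinarith
    calc |8 * p.2 / (M : ℝ) ^ 2| * ((h + 1 : ℕ) : ℝ) ^ 2
        ≤ |8 * p.2 / (M : ℝ) ^ 2| * (4 * (h : ℝ) ^ 2) :=
          mul_le_mul_of_nonneg_left this (abs_nonneg _)
      _ = _ := by ring
  have hv' : |p.2| ≤ 110 * τ := by
    have e : |8 * p.2 / (M : ℝ) ^ 2| = 8 * |p.2| / (M : ℝ) ^ 2 := by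
      rw [abs_div, abs_mul, abs_of_pos (by positivity : (0 : ℝ) < (M : ℝ) ^ 2),
        abs_of_pos (by norm_num : (0 : ℝ) < 8)]
    have hle : 8 * |p.2| / (M : ℝ) ^ 2 * ((M : ℝ) / 8) ^ 2 ≤ π / 2 * (8 * τ) := by
      rw [← e]
      refine le_trans (mul_le_mul_of_nonneg_left ?_ (abs_nonneg _)) hv
      exact pow_le_pow_left₀ (by positivity) (by linarith) 2
    have e2 : 8 * |p.2| / (M : ℝ) ^ 2 * ((M : ℝ) / 8) ^ 2 = |p.2| / 8 := by
      field_simp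
    rw [e2] at hle
    nlinarith
  refine ⟨?_, hv'⟩
  have hfirst : ∀ h : ℕ, 1 ≤ h → h ≤ H →
      |2 * Real.sin ((|2 * p.1 / M| * (h : ℝ)) / 2)| ≤ 224 * τ := by
    intro h hh1 hhH
    have hh1' : (1 : ℝ) ≤ h := by exact_mod_cast hh1
    have hhM : 4 * (h : ℝ) ≤ M := by exact_mod_cast (by omega : 4 * h ≤ M)
    have e0 : |2 * p.1 / M| * (h : ℝ) = |2 * p.1 / M * (h : ℝ)| := by
      rw [abs_mul, Nat.abs_cast]
    rw [e0, abs_two_mul_sin_abs, abs_two_mul_sin_eq]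
    have hstep : ∀ k, k < M - h →
        ‖Complex.exp (Complex.I * (2 * p.1 / M * (h : ℝ) : ℝ)) - 1‖ ≤
          d k + d (k + h) + |p.2| := by
      intro k hk
      have hk' : (k : ℝ) + h + 1 ≤ M := by exact_mod_cast (by omega : k + h + 1 ≤ M)
      have hk0 : (0 : ℝ) ≤ k := k.cast_nonneg
      set x := phase M p (k + h) - phase M p k with hx
      set y := 2 * p.1 / M * (h : ℝ) with hy
      have hyx : |y - x| ≤ |p.2| := by
        have e : y - x = p.2 * (-(4 * h * (2 * k + h + 1 - M)) / (M : ℝ) ^ 2) := by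
          simp only [hx, hy, phase, node, nodeSq]
          push_cast
          field_simp
          ring
        rw [e, abs_mul]
        refine mul_le_of_le_one_right (abs_nonneg _) ?_
        rw [abs_div, abs_of_pos (by positivity : (0 : ℝ) < (M : ℝ) ^ 2),
          div_le_one (by positivity), abs_neg, abs_mul, abs_of_nonneg (by positivity), sq]
        refine mul_le_mul hhM ?_ (abs_nonneg _) hM0.le
        rw [abs_le]
        constructor <;> linarith
      have e1 : Complex.exp (Complex.I * y) - 1 =
          Complex.exp (Complex.I * x) * (Complex.exp (Complex.I * (y - x : ℝ)) - 1) +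
            (Complex.exp (Complex.I * x) - 1) := by
        rw [mul_sub, ← Complex.exp_add,
          show Complex.I * x + Complex.I * (y - x : ℝ) = Complex.I * y by push_cast; ring]
        ring
      rw [e1]
      refine (norm_add_le _ _).trans ?_
      rw [norm_mul, mul_comm Complex.I, Complex.norm_exp_ofReal_mul_I, one_mul]
      have e2 := Real.norm_exp_I_mul_ofReal_sub_one_le (x := y - x)
      rw [Real.norm_eq_abs] at e2
      have e3 := norm_exp_difference_le hω (phase M p k) (phase M p (k + h))
      rw [mul_comm (x : ℂ) Complex.I]
      calc _ ≤ |p.2| + (d k + d (k + h)) := add_le_add (e2.trans hyx) e3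
        _ = _ := by ring
    have := card_mul_le_of_le (M := M) (n := M - h)
      (d := fun k => d k + d (k + h) + |p.2|)
      (A := ‖Complex.exp (Complex.I * (2 * p.1 / M * (h : ℝ) : ℝ)) - 1‖)
      (B := M * τ + M * τ + (M - h : ℕ) * |p.2|) hstep ?_ ?_ (norm_nonneg _)
    · have hcard : ((M - h : ℕ) : ℝ) ≤ M := by exact_mod_cast (by omega : M - h ≤ M)
      have hle : ((M - h : ℕ) : ℝ) * |p.2| ≤ M * |p.2| :=
        mul_le_mul_of_nonneg_right hcard (abs_nonneg _)
      have hle2 : (M : ℝ) * |p.2| ≤ M * (110 * τ) := mul_le_mul_of_nonneg_left hv' hM0.le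
      have h' : M * ‖Complex.exp (Complex.I * (2 * p.1 / M * (h : ℝ) : ℝ)) - 1‖ ≤
          M * (224 * τ) := by linarith
      exact le_of_mul_le_mul_left h' hM0
    · rw [Finset.sum_add_distrib, Finset.sum_add_distrib, Finset.sum_const, Finset.card_range,
        nsmul_eq_mul]
      have a0 := sum_range_shift_le hd0 (n := M - h) (h := 0) (M := M) (by omega)
      have a1 := sum_range_shift_le hd0 (n := M - h) (h := h) (M := M) (by omega)
      simp only [add_zero] at a0
      linarith
    · exact_mod_cast (by omega : M ≤ 2 * (M - h))
  have hu := le_of_abs_sin_le (s := fun h => |2 * p.1 / M| * (h : ℝ))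
    (τ := 224 * τ) (by linarith) (fun h => by positivity) ?_ ?_ hfirst H hH1 le_rfl
  rotate_left
  · rw [abs_div, abs_mul, abs_of_pos hM0,
      abs_of_pos (by norm_num : (0 : ℝ) < 2), Nat.cast_one, mul_one,
      div_le_iff₀ hM0]
    linarith
  · intro h hh
    have hh' : (1 : ℝ) ≤ h := by exact_mod_cast hh
    have : ((h + 1 : ℕ) : ℝ) ≤ 4 * (h : ℝ) := by
      push_cast
      linarith
    calc |2 * p.1 / M| * ((h + 1 : ℕ) : ℝ)
        ≤ |2 * p.1 / M| * (4 * (h : ℝ)) :=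
          mul_le_mul_of_nonneg_left this (abs_nonneg _)
      _ = _ := by ring
  have e : |2 * p.1 / M| = 2 * |p.1| / M := by
    rw [abs_div, abs_mul, abs_of_pos hM0, abs_of_pos (by norm_num : (0 : ℝ) < 2)]
  have hle : 2 * |p.1| / M * ((M : ℝ) / 8) ≤ π / 2 * (224 * τ) := by
    rw [← e]
    refine le_trans (mul_le_mul_of_nonneg_left (by linarith) (abs_nonneg _)) hu
  have e2 : 2 * |p.1| / M * ((M : ℝ) / 8) = |p.1| / 4 := by
    field_simp
    ring
  rw [e2] at hle
  nlinarith

/-- A rate of decay of the characteristic function on the period cell. -/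
noncomputable def rate : ℝ := 1 / 10 ^ 7

theorem norm_charFn_le {M : ℕ} (hM : 4 ≤ M) {p : ℝ × ℝ} (hp : p ∈ cell M) :
    ‖charFn M p‖ ≤ 1 - rate * min 1 (p.1 ^ 2 + p.2 ^ 2) := by
  unfold rate
  have h1 : |p.1| ≤ π * M / 2 := abs_le.2 ⟨hp.1.1.le, hp.1.2⟩
  have h2 : |p.2| ≤ π * (M : ℝ) ^ 2 / 8 := abs_le.2 ⟨hp.2.1.le, hp.2.2⟩
  have hn : 0 ≤ 2 * (1 - ‖charFn M p‖) := by linarith [norm_charFn_le_one M p]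
  rcases le_or_gt (√(2 * (1 - ‖charFn M p‖))) (1 / 1000) with h | h
  · obtain ⟨e1, e2⟩ := sq_add_sq_le hM h1 h2 le_rfl h
    have f1 := pow_le_pow_left₀ (abs_nonneg _) e1 2
    have f2 := pow_le_pow_left₀ (abs_nonneg _) e2 2
    rw [sq_abs, mul_pow, Real.sq_sqrt hn] at f1 f2
    have := min_le_right 1 (p.1 ^ 2 + p.2 ^ 2)
    linarith
  · have := (Real.lt_sqrt (by norm_num)).1 h
    have := min_le_left 1 (p.1 ^ 2 + p.2 ^ 2)
    linarith

theorem abs_node_le {M k : ℕ} (hk : k < M) : |node M k| ≤ 1 := by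
  have hM : (0 : ℝ) < M := by exact_mod_cast (by omega : 0 < M)
  have hk' : (k : ℝ) + 1 ≤ M := by exact_mod_cast hk
  have hk0 : (0 : ℝ) ≤ k := k.cast_nonneg
  rw [node, abs_div, abs_of_pos hM, div_le_one hM, abs_le]
  constructor <;> linarith

/-- Riemann sums at the nodes of a Lipschitz function. -/
theorem abs_mean_node_sub_integral_le {f : ℝ → ℝ} {K : ℝ} (hf : Continuous f)
    (hK : ∀ x y, |x| ≤ 1 → |y| ≤ 1 → |f x - f y| ≤ K * |x - y|) (hK0 : 0 ≤ K) {M : ℕ}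
    (hM : M ≠ 0) :
    |(∑ k ∈ Finset.range M, f (node M k)) / M - (∫ x in (-1 : ℝ)..1, f x) / 2| ≤ K / M := by
  have hM0 : (0 : ℝ) < M := by exact_mod_cast Nat.pos_of_ne_zero hM
  set a : ℕ → ℝ := fun k => -1 + 2 * k / M with ha
  have hadj := intervalIntegral.sum_integral_adjacent_intervals (f := f) (a := a) (n := M)
    (μ := volume) fun k _ => hf.intervalIntegrable _ _
  have ha0 : a 0 = -1 := by simp [ha]
  have haM : a M = 1 := by
    simp only [ha]
    field_simp
    norm_num
  rw [ha0, haM] at hadj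
  have hlen : ∀ k, a (k + 1) - a k = 2 / M := by
    intro k
    simp only [ha]
    push_cast
    ring
  have hcell : ∀ k ∈ Finset.range M,
      |(2 / M * f (node M k)) - ∫ x in a k..a (k + 1), f x| ≤ K / M * (2 / M) := by
    intro k hk
    have hk := Finset.mem_range.1 hk
    have hk' : (k : ℝ) + 1 ≤ M := by exact_mod_cast hk
    have hk0 : (0 : ℝ) ≤ k := k.cast_nonneg
    have e : 2 / M * f (node M k) - ∫ x in a k..a (k + 1), f x =
        ∫ x in a k..a (k + 1), (f (node M k) - f x) := by
      rw [intervalIntegral.integral_sub intervalIntegrable_const (hf.intervalIntegrable _ _),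
        intervalIntegral.integral_const, hlen, smul_eq_mul]
    have hnode : node M k = a k + 1 / M := by
      simp only [ha, node]
      field_simp
      ring
    have hle : a k ≤ a (k + 1) := by
      have := hlen k
      have : 0 < 2 / (M : ℝ) := by positivity
      linarith
    have h1 : -1 ≤ a k := by
      simp only [ha]
      have : 0 ≤ 2 * (k : ℝ) / M := by positivity
      linarith
    have h2 : a (k + 1) ≤ 1 := by
      simp only [ha]
      have : 2 * ((k + 1 : ℕ) : ℝ) / M ≤ 2 := by
        rw [div_le_iff₀ hM0]
        push_cast
        linarith
      linarith
    rw [e, ← Real.norm_eq_abs]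
    refine (intervalIntegral.norm_integral_le_of_norm_le_const (C := K / M) ?_).trans ?_
    · intro x hx
      rw [uIoc_of_le hle] at hx
      have := hlen k
      rw [Real.norm_eq_abs, div_eq_mul_one_div]
      refine (hK _ _ (abs_node_le hk) (abs_le.2 ⟨by linarith [hx.1], by linarith [hx.2]⟩)).trans ?_
      refine mul_le_mul_of_nonneg_left ?_ hK0
      rw [hnode, abs_le]
      have e2 : 2 / (M : ℝ) = 1 / M + 1 / M := by ring
      constructor <;> linarith [hx.1, hx.2]
    · rw [hlen, abs_of_pos (by positivity)]
  have hsum : |∑ k ∈ Finset.range M, (2 / M * f (node M k)) - ∫ x in (-1 : ℝ)..1, f x| ≤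
      M * (K / M * (2 / M)) := by
    rw [← hadj, ← Finset.sum_sub_distrib]
    refine (Finset.abs_sum_le_sum_abs _ _).trans ((Finset.sum_le_sum hcell).trans ?_)
    simp
  have e : (∑ k ∈ Finset.range M, f (node M k)) / M - (∫ x in (-1 : ℝ)..1, f x) / 2 =
      (∑ k ∈ Finset.range M, (2 / M * f (node M k)) - ∫ x in (-1 : ℝ)..1, f x) / 2 := by
    rw [← Finset.mul_sum]
    ring
  rw [e, abs_div, abs_two, div_le_iff₀ two_pos]
  refine hsum.trans (le_of_eq ?_)
  field_simp

/-- The continuous form of the phase, with an offset `c` in the centering of the square. -/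
noncomputable def quad (c : ℝ) (p : ℝ × ℝ) (x : ℝ) : ℝ := p.1 * x + p.2 * (x ^ 2 - 1 / 3 + c)

theorem phase_eq_quad (M : ℕ) (p : ℝ × ℝ) (k : ℕ) :
    phase M p k = quad (1 / (3 * (M : ℝ) ^ 2)) p (node M k) := by
  simp only [phase, nodeSq, quad]
  ring

theorem offset_mem {M : ℕ} (hM : M ≠ 0) :
    0 ≤ 1 / (3 * (M : ℝ) ^ 2) ∧ 1 / (3 * (M : ℝ) ^ 2) ≤ 1 / 3 := by
  have hM1 : (1 : ℝ) ≤ M := by exact_mod_cast Nat.pos_of_ne_zero hM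
  refine ⟨by positivity, ?_⟩
  refine one_div_le_one_div_of_le (by norm_num) ?_
  nlinarith

theorem abs_quad_le {c : ℝ} (hc : 0 ≤ c) (hc' : c ≤ 1 / 3) (p : ℝ × ℝ) {x : ℝ} (hx : |x| ≤ 1) :
    |quad c p x| ≤ |p.1| + |p.2| := by
  refine (abs_add_le _ _).trans (add_le_add ?_ ?_)
  · rw [abs_mul]
    exact mul_le_of_le_one_right (abs_nonneg _) hx
  · rw [abs_mul]
    refine mul_le_of_le_one_right (abs_nonneg _) ?_
    have h := (sq_le_one_iff_abs_le_one x).2 hx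
    rw [abs_le]
    constructor <;> nlinarith [sq_nonneg x]

theorem abs_phase_le {M k : ℕ} (hk : k < M) (p : ℝ × ℝ) : |phase M p k| ≤ |p.1| + |p.2| := by
  have h := offset_mem (M := M) (by omega)
  rw [phase_eq_quad]
  exact abs_quad_le h.1 h.2 p (abs_node_le hk)

theorem abs_quad_pow_sub_le {c : ℝ} (hc : 0 ≤ c) (hc' : c ≤ 1 / 3) (p : ℝ × ℝ) (j : ℕ) {x y : ℝ}
    (hx : |x| ≤ 1) (hy : |y| ≤ 1) :
    |quad c p x ^ j - quad c p y ^ j| ≤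
      2 * j * (|p.1| + |p.2|) * (|p.1| + |p.2|) ^ (j - 1) * |x - y| := by
  have h1 := abs_quad_le hc hc' p hx
  have h2 := abs_quad_le hc hc' p hy
  have h3 : |quad c p x - quad c p y| ≤ 2 * (|p.1| + |p.2|) * |x - y| := by
    have e : quad c p x - quad c p y = (p.1 + p.2 * (x + y)) * (x - y) := by
      simp only [quad]
      ring
    rw [e, abs_mul]
    refine mul_le_mul_of_nonneg_right ?_ (abs_nonneg _)
    refine (abs_add_le _ _).trans ?_
    rw [abs_mul]
    have := mul_le_mul_of_nonneg_left ((abs_add_le x y).trans (add_le_add hx hy)) (abs_nonneg p.2)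
    linarith [abs_nonneg p.1]
  refine (abs_pow_sub_pow_le (quad c p x) (quad c p y) j).trans ?_
  calc _ ≤ 2 * (|p.1| + |p.2|) * |x - y| * j * (|p.1| + |p.2|) ^ (j - 1) := by
        have hm := max_le h1 h2
        gcongr
    _ = _ := by ring

theorem continuous_quad (c : ℝ) (p : ℝ × ℝ) : Continuous (quad c p) := by
  unfold quad
  fun_prop

theorem abs_mean_phase_pow_sub_le {M : ℕ} (hM : M ≠ 0) (p : ℝ × ℝ) (j : ℕ) :
    |(∑ k ∈ Finset.range M, phase M p k ^ j) / M -
      (∫ x in (-1 : ℝ)..1, quad (1 / (3 * (M : ℝ) ^ 2)) p x ^ j) / 2| ≤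
      2 * j * (|p.1| + |p.2|) * (|p.1| + |p.2|) ^ (j - 1) / M := by
  have h := offset_mem hM
  simp_rw [phase_eq_quad]
  exact abs_mean_node_sub_integral_le (f := fun x => quad (1 / (3 * (M : ℝ) ^ 2)) p x ^ j)
    ((continuous_quad _ p).pow j)
    (fun x y hx hy => abs_quad_pow_sub_le h.1 h.2 p j hx hy) (by positivity) hM

theorem integral_quad_sq (c : ℝ) (p : ℝ × ℝ) :
    (∫ x in (-1 : ℝ)..1, quad c p x ^ 2) / 2 =
      p.1 ^ 2 / 3 + p.2 ^ 2 * (4 / 45 + c ^ 2) := by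
  have e : ∀ x, quad c p x ^ 2 = p.2 ^ 2 * x ^ 4 + 2 * p.1 * p.2 * x ^ 3 +
      (p.1 ^ 2 + 2 * p.2 ^ 2 * (c - 1 / 3)) * x ^ 2 + 2 * p.1 * p.2 * (c - 1 / 3) * x ^ 1 +
      p.2 ^ 2 * (c - 1 / 3) ^ 2 := by
    intro x
    simp only [quad]
    ring
  simp_rw [e]
  repeat rw [intervalIntegral.integral_add (Continuous.intervalIntegrable (by fun_prop) _ _)
    (Continuous.intervalIntegrable (by fun_prop) _ _)]
  simp only [intervalIntegral.integral_const_mul, integral_pow, intervalIntegral.integral_const]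
  norm_num
  ring

/-- The third moment of `u x + v (x² - 1/3)` for `x` uniform on `[-1, 1]`. -/
noncomputable def cumThree (p : ℝ × ℝ) : ℝ := 4 / 15 * p.1 ^ 2 * p.2 + 16 / 945 * p.2 ^ 3

/-- The fourth moment of `u x + v (x² - 1/3)` for `x` uniform on `[-1, 1]`. -/
noncomputable def momFour (p : ℝ × ℝ) : ℝ :=
  p.1 ^ 4 / 5 + 88 / 315 * p.1 ^ 2 * p.2 ^ 2 + 16 / 945 * p.2 ^ 4

theorem integral_quad_cube (p : ℝ × ℝ) :
    (∫ x in (-1 : ℝ)..1, quad 0 p x ^ 3) / 2 = cumThree p := by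
  have e : ∀ x, quad 0 p x ^ 3 = p.2 ^ 3 * x ^ 6 + 3 * p.1 * p.2 ^ 2 * x ^ 5 +
      (3 * p.1 ^ 2 * p.2 - p.2 ^ 3) * x ^ 4 + (p.1 ^ 3 - 2 * p.1 * p.2 ^ 2) * x ^ 3 +
      (p.2 ^ 3 / 3 - p.1 ^ 2 * p.2) * x ^ 2 + p.1 * p.2 ^ 2 / 3 * x ^ 1 + (-(p.2 ^ 3 / 27)) := by
    intro x
    simp only [quad]
    ring
  simp_rw [e, cumThree]
  repeat rw [intervalIntegral.integral_add (Continuous.intervalIntegrable (by fun_prop) _ _)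
    (Continuous.intervalIntegrable (by fun_prop) _ _)]
  simp only [intervalIntegral.integral_const_mul, integral_pow, intervalIntegral.integral_const]
  norm_num
  ring

theorem integral_quad_fourth (p : ℝ × ℝ) :
    (∫ x in (-1 : ℝ)..1, quad 0 p x ^ 4) / 2 = momFour p := by
  have e : ∀ x, quad 0 p x ^ 4 = p.2 ^ 4 * x ^ 8 + 4 * p.1 * p.2 ^ 3 * x ^ 7 +
      (6 * p.1 ^ 2 * p.2 ^ 2 - 4 / 3 * p.2 ^ 4) * x ^ 6 +
      (4 * p.1 ^ 3 * p.2 - 4 * p.1 * p.2 ^ 3) * x ^ 5 +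
      (p.1 ^ 4 - 4 * p.1 ^ 2 * p.2 ^ 2 + 2 / 3 * p.2 ^ 4) * x ^ 4 +
      (4 / 3 * p.1 * p.2 ^ 3 - 4 / 3 * p.1 ^ 3 * p.2) * x ^ 3 +
      (2 / 3 * p.1 ^ 2 * p.2 ^ 2 - 4 / 27 * p.2 ^ 4) * x ^ 2 +
      (-(4 / 27 * p.1 * p.2 ^ 3)) * x ^ 1 + p.2 ^ 4 / 81 := by
    intro x
    simp only [quad]
    ring
  simp_rw [e, momFour]
  repeat rw [intervalIntegral.integral_add (Continuous.intervalIntegrable (by fun_prop) _ _)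
    (Continuous.intervalIntegrable (by fun_prop) _ _)]
  simp only [intervalIntegral.integral_const_mul, integral_pow, intervalIntegral.integral_const]
  norm_num
  ring

theorem tendsto_mean_phase_pow (p : ℝ × ℝ) (j : ℕ) :
    Tendsto (fun M : ℕ => (∑ k ∈ Finset.range M, phase M p k ^ j) / M) atTop
      (𝓝 ((∫ x in (-1 : ℝ)..1, quad 0 p x ^ j) / 2)) := by
  have hc : Tendsto (fun M : ℕ => 1 / (3 * (M : ℝ) ^ 2)) atTop (𝓝 0) := by
    refine tendsto_const_nhds.div_atTop (Tendsto.const_mul_atTop (by norm_num) ?_)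
    exact (tendsto_pow_atTop two_ne_zero).comp tendsto_natCast_atTop_atTop
  have hcont : Continuous fun c : ℝ => ∫ x in (-1 : ℝ)..1, quad c p x ^ j := by
    refine intervalIntegral.continuous_parametric_intervalIntegral_of_continuous' ?_ _ _
    unfold Function.uncurry quad
    fun_prop
  have hintegral := (hcont.continuousAt.tendsto.comp hc).div_const 2
  have herr : Tendsto (fun M : ℕ => (∑ k ∈ Finset.range M, phase M p k ^ j) / M -
      (∫ x in (-1 : ℝ)..1, quad (1 / (3 * (M : ℝ) ^ 2)) p x ^ j) / 2) atTop (𝓝 0) := by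
    refine squeeze_zero_norm' (a := fun M : ℕ =>
      2 * j * (|p.1| + |p.2|) * (|p.1| + |p.2|) ^ (j - 1) / (M : ℝ)) ?_
      (tendsto_const_nhds.div_atTop tendsto_natCast_atTop_atTop)
    filter_upwards [eventually_ne_atTop 0] with M hM
    rw [Real.norm_eq_abs]
    exact abs_mean_phase_pow_sub_le hM p j
  have := herr.add hintegral
  rw [zero_add] at this
  refine this.congr fun M => ?_
  simp only [Function.comp_apply]
  ring

theorem sum_affine (c : ℝ) (n : ℕ) :
    ∑ k ∈ Finset.range n, (2 * (k : ℝ) + 1 - c) = n ^ 2 - c * n := by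
  induction n with
  | zero => simp
  | succ n ih =>
    rw [Finset.sum_range_succ, ih]
    push_cast
    ring

theorem sum_affine_sq (c : ℝ) (n : ℕ) :
    ∑ k ∈ Finset.range n, (2 * (k : ℝ) + 1 - c) ^ 2 =
      n * (4 * n ^ 2 - 1) / 3 - 2 * c * n ^ 2 + c ^ 2 * n := by
  induction n with
  | zero => simp
  | succ n ih =>
    rw [Finset.sum_range_succ, ih]
    push_cast
    ring

theorem sum_phase (M : ℕ) (p : ℝ × ℝ) : ∑ k ∈ Finset.range M, phase M p k = 0 := by
  rcases Nat.eq_zero_or_pos M with rfl | hM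
  · simp
  have hM0 : (M : ℝ) ≠ 0 := by positivity
  simp only [phase, nodeSq, node, div_pow]
  rw [Finset.sum_add_distrib, ← Finset.mul_sum, ← Finset.mul_sum, Finset.sum_sub_distrib,
    ← Finset.sum_div, ← Finset.sum_div, sum_affine, sum_affine_sq, Finset.sum_const,
    Finset.card_range, nsmul_eq_mul]
  field_simp
  ring

/-- Half the variance of `u x + v (x² - 1/3)` for `x` uniform on `[-1, 1]`. -/
noncomputable def quadForm (p : ℝ × ℝ) : ℝ := p.1 ^ 2 / 6 + 2 / 45 * p.2 ^ 2

theorem abs_mean_phase_sq_sub_le {M : ℕ} (hM : M ≠ 0) (p : ℝ × ℝ) :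
    |(∑ k ∈ Finset.range M, phase M p k ^ 2) / M - 2 * quadForm p| ≤
      9 * (p.1 ^ 2 + p.2 ^ 2) / M := by
  have h := abs_mean_phase_pow_sub_le hM p 2
  rw [integral_quad_sq] at h
  have hM1 : (1 : ℝ) ≤ M := by exact_mod_cast Nat.pos_of_ne_zero hM
  have hc : (1 / (3 * (M : ℝ) ^ 2)) ^ 2 ≤ 1 / M := by
    rw [div_pow, one_pow]
    refine one_div_le_one_div_of_le (by linarith) ?_
    have h2 : (1 : ℝ) ≤ M ^ 3 := one_le_pow₀ hM1
    have e : (3 * (M : ℝ) ^ 2) ^ 2 = 9 * M ^ 3 * M := by ring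
    rw [e]
    nlinarith
  have hc' := mul_le_mul_of_nonneg_left hc (sq_nonneg p.2)
  have hR : 2 * ((2 : ℕ) : ℝ) * (|p.1| + |p.2|) * (|p.1| + |p.2|) ^ (2 - 1) / M ≤
      8 * (p.1 ^ 2 + p.2 ^ 2) / M := by
    refine div_le_div_of_nonneg_right ?_ M.cast_nonneg
    norm_num
    nlinarith [sq_nonneg (|p.1| - |p.2|), sq_abs p.1, sq_abs p.2]
  have hc0 : 0 ≤ p.2 ^ 2 * (1 / (3 * (M : ℝ) ^ 2)) ^ 2 := by positivity
  have h9 : p.2 ^ 2 * (1 / (M : ℝ)) ≤ (p.1 ^ 2 + p.2 ^ 2) / M := by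
    rw [mul_one_div]
    gcongr
    linarith [sq_nonneg p.1]
  have e9 : 9 * (p.1 ^ 2 + p.2 ^ 2) / M = 8 * (p.1 ^ 2 + p.2 ^ 2) / M + (p.1 ^ 2 + p.2 ^ 2) / M := by
    ring
  rw [abs_le] at h ⊢
  rw [e9]
  simp only [quadForm]
  constructor <;> linarith [h.1, h.2]

theorem re_chi (M : ℕ) (p : ℝ × ℝ) (k : ℕ) : (chi M p k).re = Real.cos (phase M p k) := by
  rw [chi, mul_comm, Complex.exp_ofReal_mul_I_re]

theorem im_chi (M : ℕ) (p : ℝ × ℝ) (k : ℕ) : (chi M p k).im = Real.sin (phase M p k) := by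
  rw [chi, mul_comm, Complex.exp_ofReal_mul_I_im]

theorem re_charFn (M : ℕ) (p : ℝ × ℝ) :
    (charFn M p).re = (∑ k ∈ Finset.range M, Real.cos (phase M p k)) / M := by
  rw [charFn, Complex.div_natCast_re, Complex.re_sum]
  simp_rw [re_chi]

theorem im_charFn (M : ℕ) (p : ℝ × ℝ) :
    (charFn M p).im = (∑ k ∈ Finset.range M, Real.sin (phase M p k)) / M := by
  rw [charFn, Complex.div_natCast_im, Complex.im_sum]
  simp_rw [im_chi]

theorem abs_mean_sub_mean_le {M : ℕ} (hM : M ≠ 0) {f g : ℕ → ℝ} {B : ℝ}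
    (h : ∀ k < M, |f k - g k| ≤ B) :
    |(∑ k ∈ Finset.range M, f k) / M - (∑ k ∈ Finset.range M, g k) / M| ≤ B := by
  have hM0 : (0 : ℝ) < M := by exact_mod_cast Nat.pos_of_ne_zero hM
  rw [← sub_div, ← Finset.sum_sub_distrib, abs_div, Nat.abs_cast, div_le_iff₀ hM0]
  refine (Finset.abs_sum_le_sum_abs _ _).trans
    ((Finset.sum_le_sum fun k hk => h k (Finset.mem_range.1 hk)).trans ?_)
  rw [Finset.sum_const, Finset.card_range, nsmul_eq_mul, mul_comm]

theorem sq_add_abs_le (p : ℝ × ℝ) : (|p.1| + |p.2|) ^ 2 ≤ 2 * (p.1 ^ 2 + p.2 ^ 2) := by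
  nlinarith [sq_nonneg (|p.1| - |p.2|), sq_abs p.1, sq_abs p.2]

theorem quadForm_nonneg (p : ℝ × ℝ) : 0 ≤ quadForm p := by
  unfold quadForm
  positivity

theorem quadForm_le (p : ℝ × ℝ) : quadForm p ≤ (p.1 ^ 2 + p.2 ^ 2) / 6 := by
  unfold quadForm
  linarith [sq_nonneg p.2]

theorem le_quadForm (p : ℝ × ℝ) : 2 / 45 * (p.1 ^ 2 + p.2 ^ 2) ≤ quadForm p := by
  unfold quadForm
  linarith [sq_nonneg p.1]

/-- The neighbourhood of the origin in which the characteristic function is expanded. -/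
def box : Set (ℝ × ℝ) := {p | |p.1| ≤ 1 / 2 ∧ |p.2| ≤ 1 / 2}

theorem norm_sq_le_of_mem_box {p : ℝ × ℝ} (hp : p ∈ box) : p.1 ^ 2 + p.2 ^ 2 ≤ 1 / 2 := by
  have h1 := pow_le_pow_left₀ (abs_nonneg _) hp.1 2
  have h2 := pow_le_pow_left₀ (abs_nonneg _) hp.2 2
  rw [sq_abs] at h1 h2
  linarith

theorem abs_re_charFn_sub_le {M : ℕ} (hM : M ≠ 0) {p : ℝ × ℝ} (hp : p ∈ box) :
    |(charFn M p).re - Real.exp (-quadForm p)| ≤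
      (p.1 ^ 2 + p.2 ^ 2) ^ 2 + 5 * (p.1 ^ 2 + p.2 ^ 2) / M := by
  have hM0 : (M : ℝ) ≠ 0 := by exact_mod_cast hM
  have hMpos : (0 : ℝ) < M := by positivity
  set ρ := p.1 ^ 2 + p.2 ^ 2 with hρ
  have hρ0 : 0 ≤ ρ := by positivity
  have hρ1 : ρ ≤ 1 / 2 := norm_sq_le_of_mem_box hp
  have hR : (|p.1| + |p.2|) ≤ 1 := by linarith [hp.1, hp.2]
  have hR4 : (|p.1| + |p.2|) ^ 4 ≤ 4 * ρ ^ 2 := by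
    have := pow_le_pow_left₀ (by positivity) (sq_add_abs_le p) 2
    calc _ = ((|p.1| + |p.2|) ^ 2) ^ 2 := by ring
      _ ≤ _ := this
      _ = _ := by ring
  have h1 : |(charFn M p).re - (∑ k ∈ Finset.range M, (1 - phase M p k ^ 2 / 2)) / M| ≤
      4 * ρ ^ 2 * (5 / 96) := by
    rw [re_charFn]
    refine abs_mean_sub_mean_le hM fun k hk => ?_
    have hL := abs_phase_le hk p
    refine (Real.cos_bound (hL.trans hR)).trans ?_
    have := pow_le_pow_left₀ (abs_nonneg _) hL 4
    linarith
  have h2 : (∑ k ∈ Finset.range M, (1 - phase M p k ^ 2 / 2)) / M =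
      1 - (∑ k ∈ Finset.range M, phase M p k ^ 2) / M / 2 := by
    rw [Finset.sum_sub_distrib, ← Finset.sum_div, Finset.sum_const, Finset.card_range,
      nsmul_eq_mul]
    field_simp
  have h3 := abs_mean_phase_sq_sub_le hM p
  have hQ0 := quadForm_nonneg p
  have hQ1 := quadForm_le p
  have h4 : |Real.exp (-quadForm p) - 1 - -quadForm p| ≤ quadForm p ^ 2 := by
    have := Real.abs_exp_sub_one_sub_id_le (x := -quadForm p) (by
      rw [abs_neg, abs_of_nonneg hQ0]
      linarith)
    rwa [neg_sq] at this
  have h5 : quadForm p ^ 2 ≤ (ρ / 6) ^ 2 := pow_le_pow_left₀ hQ0 hQ1 2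
  rw [h2] at h1
  have e5 : 9 * ρ / M = 9 * (ρ / M) := by ring
  have e6 : 5 * ρ / M = 5 * (ρ / M) := by ring
  have hρM : 0 ≤ ρ / M := by positivity
  rw [← hρ, e5] at h3
  rw [e6]
  rw [abs_le] at *
  constructor <;> nlinarith [h1.1, h1.2, h3.1, h3.2, h4.1, h4.2]

theorem im_charFn_sq_le {M : ℕ} (hM : M ≠ 0) (p : ℝ × ℝ) :
    (charFn M p).im ^ 2 ≤ (p.1 ^ 2 + p.2 ^ 2) ^ 3 := by
  have h1 : |(charFn M p).im| ≤ (|p.1| + |p.2|) ^ 3 / 6 := by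
    have := abs_mean_sub_mean_le hM (f := fun k => Real.sin (phase M p k))
      (g := fun k => phase M p k) (B := (|p.1| + |p.2|) ^ 3 / 6) fun k hk => by
        rw [abs_sub_comm]
        refine (Real.abs_sub_sin_le _).trans ?_
        gcongr
        exact abs_phase_le hk p
    rwa [sum_phase, zero_div, sub_zero, ← im_charFn] at this
  have h2 := pow_le_pow_left₀ (abs_nonneg _) h1 2
  rw [sq_abs] at h2
  refine h2.trans ?_
  have h3 := pow_le_pow_left₀ (by positivity) (sq_add_abs_le p) 3
  calc ((|p.1| + |p.2|) ^ 3 / 6) ^ 2 = ((|p.1| + |p.2|) ^ 2) ^ 3 / 36 := by ring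
    _ ≤ (2 * (p.1 ^ 2 + p.2 ^ 2)) ^ 3 / 36 := by linarith
    _ ≤ _ := by
      have : 0 ≤ (p.1 ^ 2 + p.2 ^ 2) ^ 3 := by positivity
      rw [mul_pow]
      linarith

theorem norm_exp_I_mul_sub_le {x : ℝ} (hx : |x| ≤ 1) :
    ‖Complex.exp (Complex.I * x) - ((1 - x ^ 2 / 2 + x ^ 4 / 24 : ℝ) +
      Complex.I * (x - x ^ 3 / 6 : ℝ))‖ ≤ |x| ^ 5 := by
  have hn : ‖Complex.I * (x : ℂ)‖ = |x| := by simp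
  have h := Complex.exp_bound (x := Complex.I * x) (by rwa [hn]) (n := 5) (by norm_num)
  rw [hn] at h
  have e : ∑ m ∈ Finset.range 5, (Complex.I * (x : ℂ)) ^ m / (m.factorial : ℂ) =
      ((1 - x ^ 2 / 2 + x ^ 4 / 24 : ℝ) + Complex.I * (x - x ^ 3 / 6 : ℝ)) := by
    have h2 : Complex.I ^ 3 = -Complex.I := Complex.I_pow_three
    simp only [Finset.sum_range_succ, Finset.sum_range_zero, Nat.factorial, mul_pow,
      Complex.I_sq, Complex.I_pow_four, h2]
    push_cast
    ring
  rw [e] at h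
  refine h.trans (mul_le_of_le_one_right (by positivity) ?_)
  norm_num [Nat.factorial]

theorem norm_charFn_sub_le {M : ℕ} (hM : M ≠ 0) {p : ℝ × ℝ} (hp : |p.1| + |p.2| ≤ 1) :
    |(charFn M p).re - (1 - (∑ k ∈ Finset.range M, phase M p k ^ 2) / M / 2 +
      (∑ k ∈ Finset.range M, phase M p k ^ 4) / M / 24)| ≤ (|p.1| + |p.2|) ^ 5 ∧
    |(charFn M p).im + (∑ k ∈ Finset.range M, phase M p k ^ 3) / M / 6| ≤
      (|p.1| + |p.2|) ^ 5 := by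
  have hM0 : (M : ℝ) ≠ 0 := by exact_mod_cast hM
  have hk : ∀ k < M, ‖chi M p k - ((1 - phase M p k ^ 2 / 2 + phase M p k ^ 4 / 24 : ℝ) +
      Complex.I * (phase M p k - phase M p k ^ 3 / 6 : ℝ))‖ ≤ (|p.1| + |p.2|) ^ 5 := by
    intro k hk
    have hL := abs_phase_le hk p
    exact (norm_exp_I_mul_sub_le (hL.trans hp)).trans
      (pow_le_pow_left₀ (abs_nonneg _) hL 5)
  constructor
  · have h := abs_mean_sub_mean_le hM (f := fun k => Real.cos (phase M p k))
      (g := fun k => 1 - phase M p k ^ 2 / 2 + phase M p k ^ 4 / 24) fun k hk' => by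
        have := (Complex.abs_re_le_norm _).trans (hk k hk')
        rwa [Complex.sub_re, re_chi, Complex.add_re, Complex.ofReal_re, Complex.I_mul_re,
          Complex.ofReal_im, neg_zero, add_zero] at this
    rw [← re_charFn] at h
    convert h using 3
    rw [Finset.sum_add_distrib, Finset.sum_sub_distrib, ← Finset.sum_div, ← Finset.sum_div,
      Finset.sum_const, Finset.card_range, nsmul_eq_mul]
    field_simp
  · have h := abs_mean_sub_mean_le hM (f := fun k => Real.sin (phase M p k))
      (g := fun k => phase M p k - phase M p k ^ 3 / 6) fun k hk' => by
        have := (Complex.abs_im_le_norm _).trans (hk k hk')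
        rwa [Complex.sub_im, im_chi, Complex.add_im, Complex.ofReal_im, Complex.I_mul_im,
          Complex.ofReal_re, zero_add] at this
    rw [← im_charFn] at h
    convert h using 2
    rw [Finset.sum_sub_distrib, ← Finset.sum_div, sum_phase]
    ring

theorem phase_smul (M : ℕ) (t : ℝ) (p : ℝ × ℝ) (k : ℕ) :
    phase M (t • p) k = t * phase M p k := by
  simp only [phase, Prod.smul_fst, Prod.smul_snd, smul_eq_mul]
  ring

theorem quadForm_smul (t : ℝ) (p : ℝ × ℝ) : quadForm (t • p) = t ^ 2 * quadForm p := by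
  simp only [quadForm, Prod.smul_fst, Prod.smul_snd, smul_eq_mul]
  ring

theorem tendsto_inv_sqrt : Tendsto (fun N : ℕ => (√(N : ℝ))⁻¹) atTop (𝓝 0) :=
  (Real.tendsto_sqrt_atTop.comp tendsto_natCast_atTop_atTop).inv_tendsto_atTop

theorem tendsto_cube : Tendsto (fun N : ℕ => N ^ 3) atTop atTop :=
  tendsto_pow_atTop (by norm_num)

/-- The limit of the rescaled real part of the deviation from the Gaussian. -/
noncomputable def devRe (p : ℝ × ℝ) : ℝ := momFour p / 24 - quadForm p ^ 2 / 2

theorem eventually_abs_add_le (p : ℝ × ℝ) :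
    ∀ᶠ N : ℕ in atTop, |((√(N : ℝ))⁻¹ • p).1| + |((√(N : ℝ))⁻¹ • p).2| =
      (√(N : ℝ))⁻¹ * (|p.1| + |p.2|) ∧ (√(N : ℝ))⁻¹ * (|p.1| + |p.2|) ≤ 1 / 2 ∧ N ≠ 0 := by
  have h := tendsto_inv_sqrt.mul_const (|p.1| + |p.2|)
  rw [zero_mul] at h
  filter_upwards [h.eventually (ge_mem_nhds (by norm_num : (0 : ℝ) < 1 / 2)),
    eventually_ne_atTop 0] with N hN hN0
  refine ⟨?_, hN, hN0⟩
  have : 0 ≤ (√(N : ℝ))⁻¹ := by positivity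
  rw [Prod.smul_fst, Prod.smul_snd, smul_eq_mul, smul_eq_mul, abs_mul, abs_mul, abs_of_nonneg this]
  ring

theorem tendsto_re_deviation (p : ℝ × ℝ) :
    Tendsto (fun N : ℕ => (N : ℝ) ^ 2 *
      ((charFn (N ^ 3) ((√(N : ℝ))⁻¹ • p)).re - Real.exp (-(quadForm p / N)))) atTop
      (𝓝 (devRe p)) := by
  set m : ℕ → ℕ → ℝ := fun j N => (∑ k ∈ Finset.range (N ^ 3), phase (N ^ 3) p k ^ j) / (N ^ 3 : ℕ)
    with hm
  have hm4 : Tendsto (m 4) atTop (𝓝 (momFour p)) := by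
    have := (tendsto_mean_phase_pow p 4).comp tendsto_cube
    rwa [integral_quad_fourth] at this
  have h1 : Tendsto (fun N : ℕ => (N : ℝ) ^ 2 *
      ((charFn (N ^ 3) ((√(N : ℝ))⁻¹ • p)).re - (1 - m 2 N / N / 2 + m 4 N / N ^ 2 / 24))) atTop
      (𝓝 0) := by
    have hb := tendsto_inv_sqrt.mul_const ((|p.1| + |p.2|) ^ 5)
    rw [zero_mul] at hb
    refine squeeze_zero_norm' ?_ hb
    filter_upwards [eventually_abs_add_le p] with N ⟨e1, e2, e3⟩
    have hN : (0 : ℝ) < N := by exact_mod_cast Nat.pos_of_ne_zero e3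
    have hs : 0 < √(N : ℝ) := Real.sqrt_pos.2 hN
    have hsN : √(N : ℝ) ^ 2 = N := Real.sq_sqrt hN.le
    have h := (norm_charFn_sub_le (M := N ^ 3) (by positivity) (p := (√(N : ℝ))⁻¹ • p)
      (by rw [e1]; linarith)).1
    simp_rw [phase_smul, mul_pow] at h
    rw [← Finset.mul_sum, ← Finset.mul_sum, e1] at h
    have f2 : (√(N : ℝ))⁻¹ ^ 2 * (∑ k ∈ Finset.range (N ^ 3), phase (N ^ 3) p k ^ 2) /
        (N ^ 3 : ℕ) / 2 = m 2 N / N / 2 := by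
      rw [inv_pow, hsN]
      simp only [hm]
      ring
    have f4 : (√(N : ℝ))⁻¹ ^ 4 * (∑ k ∈ Finset.range (N ^ 3), phase (N ^ 3) p k ^ 4) /
        (N ^ 3 : ℕ) / 24 = m 4 N / N ^ 2 / 24 := by
      rw [inv_pow, show √(N : ℝ) ^ 4 = (√(N : ℝ) ^ 2) ^ 2 by ring, hsN]
      simp only [hm]
      ring
    rw [f2, f4] at h
    rw [Real.norm_eq_abs, abs_mul, abs_of_nonneg (by positivity)]
    refine (mul_le_mul_of_nonneg_left h (by positivity)).trans (le_of_eq ?_)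
    rw [← hsN]
    rw [Real.sqrt_sq hs.le]
    field_simp
  have h2 : Tendsto (fun N : ℕ => (N : ℝ) * (quadForm p - m 2 N / 2)) atTop (𝓝 0) := by
    have hb : Tendsto (fun N : ℕ => 9 * (p.1 ^ 2 + p.2 ^ 2) / (N : ℝ)) atTop (𝓝 0) :=
      tendsto_const_nhds.div_atTop tendsto_natCast_atTop_atTop
    refine squeeze_zero_norm' ?_ hb
    filter_upwards [eventually_ge_atTop 1] with N hN
    have hN1 : (1 : ℝ) ≤ N := by exact_mod_cast hN
    have h := abs_mean_phase_sq_sub_le (M := N ^ 3) (by positivity) p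
    have e : (N : ℝ) * (quadForm p - m 2 N / 2) = -(N / 2 * (m 2 N - 2 * quadForm p)) := by ring
    rw [e, norm_neg, Real.norm_eq_abs, abs_mul, abs_of_nonneg (by positivity)]
    refine (mul_le_mul_of_nonneg_left h (by positivity)).trans ?_
    push_cast
    rw [show (N : ℝ) / 2 * (9 * (p.1 ^ 2 + p.2 ^ 2) / N ^ 3) =
      (9 * (p.1 ^ 2 + p.2 ^ 2)) / (2 * N ^ 2) by field_simp]
    refine div_le_div_of_nonneg_left (by positivity) (by positivity) ?_
    nlinarith
  have h3 : Tendsto (fun N : ℕ => (N : ℝ) ^ 2 * (1 - quadForm p / N + (quadForm p / N) ^ 2 / 2 -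
      Real.exp (-(quadForm p / N)))) atTop (𝓝 0) := by
    have hb : Tendsto (fun N : ℕ => quadForm p ^ 3 / (N : ℝ)) atTop (𝓝 0) :=
      tendsto_const_nhds.div_atTop tendsto_natCast_atTop_atTop
    have hq : Tendsto (fun N : ℕ => quadForm p / (N : ℝ)) atTop (𝓝 0) :=
      tendsto_const_nhds.div_atTop tendsto_natCast_atTop_atTop
    refine squeeze_zero_norm' ?_ hb
    filter_upwards [hq.eventually (ge_mem_nhds zero_lt_one), eventually_ge_atTop 1] with N hq1 hN
    have hN1 : (1 : ℝ) ≤ N := by exact_mod_cast hN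
    have hq0 : 0 ≤ quadForm p / N := div_nonneg (quadForm_nonneg p) (by linarith)
    have h := Real.exp_bound (x := -(quadForm p / N)) (by rwa [abs_neg, abs_of_nonneg hq0])
      (n := 3) (by norm_num)
    rw [abs_neg, abs_of_nonneg hq0] at h
    have hsum : ∑ m ∈ Finset.range 3, (-(quadForm p / N)) ^ m / (m.factorial : ℝ) =
        1 - quadForm p / N + (quadForm p / N) ^ 2 / 2 := by
      simp [Finset.sum_range_succ, Nat.factorial]
      ring
    rw [hsum, abs_sub_comm] at h
    rw [Real.norm_eq_abs, abs_mul, abs_of_nonneg (by positivity)]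
    have h' : |1 - quadForm p / N + (quadForm p / N) ^ 2 / 2 - Real.exp (-(quadForm p / N))| ≤
        (quadForm p / N) ^ 3 := by
      refine h.trans (mul_le_of_le_one_right (by positivity) ?_)
      norm_num [Nat.factorial]
    refine (mul_le_mul_of_nonneg_left h' (by positivity)).trans (le_of_eq ?_)
    field_simp
  have h4 : Tendsto (fun N => m 4 N / 24 - quadForm p ^ 2 / 2) atTop (𝓝 (devRe p)) :=
    (hm4.div_const 24).sub_const _
  have := ((h1.add h2).add h3).add h4
  rw [add_zero, zero_add, zero_add] at this
  refine this.congr' ?_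
  filter_upwards [eventually_ne_atTop 0] with N hN
  have hN' : (N : ℝ) ≠ 0 := by exact_mod_cast hN
  field_simp
  ring

theorem tendsto_im_deviation (p : ℝ × ℝ) :
    Tendsto (fun N : ℕ => √(N : ℝ) ^ 3 * (charFn (N ^ 3) ((√(N : ℝ))⁻¹ • p)).im) atTop
      (𝓝 (-(cumThree p / 6))) := by
  set m : ℕ → ℝ := fun N => (∑ k ∈ Finset.range (N ^ 3), phase (N ^ 3) p k ^ 3) / (N ^ 3 : ℕ)
    with hm
  have hm3 : Tendsto m atTop (𝓝 (cumThree p)) := by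
    have := (tendsto_mean_phase_pow p 3).comp tendsto_cube
    rwa [integral_quad_cube] at this
  have h1 : Tendsto (fun N : ℕ => √(N : ℝ) ^ 3 * (charFn (N ^ 3) ((√(N : ℝ))⁻¹ • p)).im + m N / 6)
      atTop (𝓝 0) := by
    have hb := (tendsto_inv_sqrt.pow 2).mul_const ((|p.1| + |p.2|) ^ 5)
    rw [zero_pow two_ne_zero, zero_mul] at hb
    refine squeeze_zero_norm' ?_ hb
    filter_upwards [eventually_abs_add_le p] with N ⟨e1, e2, e3⟩
    have hN : (0 : ℝ) < N := by exact_mod_cast Nat.pos_of_ne_zero e3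
    have hs : 0 < √(N : ℝ) := Real.sqrt_pos.2 hN
    have h := (norm_charFn_sub_le (M := N ^ 3) (by positivity) (p := (√(N : ℝ))⁻¹ • p)
      (by rw [e1]; linarith)).2
    simp_rw [phase_smul, mul_pow] at h
    rw [← Finset.mul_sum, e1] at h
    have e : √(N : ℝ) ^ 3 * (charFn (N ^ 3) ((√(N : ℝ))⁻¹ • p)).im + m N / 6 =
        √(N : ℝ) ^ 3 * ((charFn (N ^ 3) ((√(N : ℝ))⁻¹ • p)).im + (√(N : ℝ))⁻¹ ^ 3 *
          (∑ k ∈ Finset.range (N ^ 3), phase (N ^ 3) p k ^ 3) / (N ^ 3 : ℕ) / 6) := by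
      simp only [hm]
      field_simp
    rw [e, Real.norm_eq_abs, abs_mul, abs_of_nonneg (by positivity)]
    refine (mul_le_mul_of_nonneg_left h (by positivity)).trans (le_of_eq ?_)
    field_simp
  have := h1.sub (hm3.div_const 6)
  rw [zero_sub] at this
  refine this.congr fun N => ?_
  ring

theorem norm_pow_sub_linear_le {w q : ℂ} {m : ℝ} (hw : ‖w‖ ≤ m) (hq : ‖q‖ ≤ m) (n : ℕ) :
    ‖w ^ (n + 2) - q ^ (n + 2) - (n + 2) * q ^ (n + 1) * (w - q)‖ ≤
      (n + 2) ^ 2 * ‖w - q‖ ^ 2 * m ^ n := by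
  have hm : 0 ≤ m := (norm_nonneg _).trans hw
  induction n with
  | zero =>
    have e : w ^ (0 + 2) - q ^ (0 + 2) - ((0 : ℕ) + 2) * q ^ (0 + 1) * (w - q) = (w - q) ^ 2 := by
      push_cast
      ring
    rw [e, norm_pow]
    have := sq_nonneg ‖w - q‖
    norm_num
    linarith
  | succ n ih =>
    have e : w ^ (n + 1 + 2) - q ^ (n + 1 + 2) -
        ((n + 1 : ℕ) + 2) * q ^ (n + 1 + 1) * (w - q) =
        w * (w ^ (n + 2) - q ^ (n + 2) - (n + 2) * q ^ (n + 1) * (w - q)) +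
          (n + 2 : ℕ) * (q ^ (n + 1) * (w - q) ^ 2) := by
      push_cast
      ring
    rw [e]
    refine (norm_add_le _ _).trans ?_
    rw [norm_mul, norm_mul, norm_mul, norm_pow, norm_pow, Complex.norm_natCast]
    have h1 : ‖w‖ * ‖w ^ (n + 2) - q ^ (n + 2) - (n + 2) * q ^ (n + 1) * (w - q)‖ ≤
        m * ((n + 2) ^ 2 * ‖w - q‖ ^ 2 * m ^ n) := mul_le_mul hw ih (norm_nonneg _) hm
    have h2 : ((n + 2 : ℕ) : ℝ) * (‖q‖ ^ (n + 1) * ‖w - q‖ ^ 2) ≤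
        ((n + 2 : ℕ) : ℝ) * (m ^ (n + 1) * ‖w - q‖ ^ 2) := by gcongr
    refine (add_le_add h1 h2).trans ?_
    have h3 : 0 ≤ m ^ (n + 1) * ‖w - q‖ ^ 2 := by positivity
    have hn : (0 : ℝ) ≤ n := n.cast_nonneg
    push_cast
    have e2 : m * ((n + 2) ^ 2 * ‖w - q‖ ^ 2 * m ^ n) + (n + 2) * (m ^ (n + 1) * ‖w - q‖ ^ 2) =
        ((n + 2) ^ 2 + (n + 2)) * (m ^ (n + 1) * ‖w - q‖ ^ 2) := by ring
    have e3 : ((n : ℝ) + 1 + 2) ^ 2 * ‖w - q‖ ^ 2 * m ^ (n + 1) =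
        (n + 1 + 2) ^ 2 * (m ^ (n + 1) * ‖w - q‖ ^ 2) := by ring
    rw [e2, e3]
    refine mul_le_mul_of_nonneg_right ?_ h3
    nlinarith

theorem norm_one_add_pow_sub_le (ε : ℂ) (n : ℕ) :
    ‖(1 + ε) ^ n - (1 + n * ε + n * (n - 1) / 2 * ε ^ 2)‖ ≤ n ^ 3 * ‖ε‖ ^ 3 * (1 + ‖ε‖) ^ n := by
  induction n with
  | zero => simp
  | succ n ih =>
    have e : (1 + ε) ^ (n + 1) -
        (1 + (n + 1 : ℕ) * ε + (n + 1 : ℕ) * ((n + 1 : ℕ) - 1) / 2 * ε ^ 2) =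
        (1 + ε) * ((1 + ε) ^ n - (1 + n * ε + n * (n - 1) / 2 * ε ^ 2)) +
          n * (n - 1) / 2 * ε ^ 3 := by
      push_cast
      ring
    have hn : (0 : ℝ) ≤ n := n.cast_nonneg
    have h1 : ‖(1 + ε)‖ ≤ 1 + ‖ε‖ := (norm_add_le _ _).trans (by rw [norm_one])
    have h2 : ‖((n : ℂ) * (n - 1) / 2)‖ ≤ n ^ 2 := by
      rcases Nat.eq_zero_or_pos n with rfl | h
      · simp
      have h1n : (1 : ℝ) ≤ n := by exact_mod_cast h
      have e2 : ((n : ℂ) * (n - 1) / 2) = ((n * (n - 1) / 2 : ℝ) : ℂ) := by push_cast; ring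
      rw [e2, Complex.norm_real, Real.norm_eq_abs, abs_of_nonneg (by nlinarith)]
      nlinarith
    have h3 : 1 ≤ (1 + ‖ε‖) ^ (n + 1) := one_le_pow₀ (by linarith [norm_nonneg ε])
    rw [e]
    refine (norm_add_le _ _).trans ?_
    rw [norm_mul, norm_mul, norm_pow]
    have a1 := mul_le_mul h1 ih (norm_nonneg _) (by positivity)
    have a2 : ‖((n : ℂ) * (n - 1) / 2)‖ * ‖ε‖ ^ 3 ≤ n ^ 2 * ‖ε‖ ^ 3 * (1 + ‖ε‖) ^ (n + 1) := by
      refine (mul_le_mul_of_nonneg_right h2 (by positivity)).trans ?_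
      exact le_mul_of_one_le_right (by positivity) h3
    refine (add_le_add a1 a2).trans ?_
    have e3 : (1 + ‖ε‖) * ((n : ℝ) ^ 3 * ‖ε‖ ^ 3 * (1 + ‖ε‖) ^ n) +
        n ^ 2 * ‖ε‖ ^ 3 * (1 + ‖ε‖) ^ (n + 1) =
        (n ^ 3 + n ^ 2) * (‖ε‖ ^ 3 * (1 + ‖ε‖) ^ (n + 1)) := by ring
    rw [e3]
    push_cast
    rw [mul_assoc]
    refine mul_le_mul_of_nonneg_right ?_ (by positivity)
    nlinarith [sq_nonneg (n : ℝ)]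

theorem tendsto_mul_one_add_pow_sub_one {a b : ℕ → ℝ} {α β : ℝ}
    (ha : Tendsto (fun N : ℕ => (N : ℝ) ^ 2 * a N) atTop (𝓝 α))
    (hb : Tendsto (fun N : ℕ => √(N : ℝ) ^ 3 * b N) atTop (𝓝 β)) :
    Tendsto (fun N : ℕ => (N : ℝ) * (((1 + ((a N : ℂ) + Complex.I * b N)) ^ N).re - 1)) atTop
      (𝓝 (α - β ^ 2 / 2)) := by
  have hinv : Tendsto (fun N : ℕ => (N : ℝ)⁻¹) atTop (𝓝 0) :=
    tendsto_natCast_atTop_atTop.inv_tendsto_atTop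
  set ε : ℕ → ℂ := fun N => (a N : ℂ) + Complex.I * b N with hε
  set E : ℕ → ℝ := fun N => |a N| + |b N| with hE
  have hεE : ∀ N, ‖ε N‖ ≤ E N := by
    intro N
    refine (norm_add_le _ _).trans ?_
    simp [hE]
  have hE0 : ∀ N, 0 ≤ E N := fun N => by positivity
  have hscale : Tendsto (fun N : ℕ => √(N : ℝ) ^ 3 * E N) atTop (𝓝 |β|) := by
    have h := ((ha.abs.mul tendsto_inv_sqrt).add hb.abs)
    rw [mul_zero, zero_add] at h
    refine h.congr' ?_
    filter_upwards [eventually_gt_atTop 0] with N hN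
    have hN' : (0 : ℝ) < N := by exact_mod_cast hN
    have hs : 0 < √(N : ℝ) := Real.sqrt_pos.2 hN'
    rw [abs_mul, abs_mul, abs_of_nonneg (by positivity : 0 ≤ (N : ℝ) ^ 2),
      abs_of_nonneg (by positivity : 0 ≤ √(N : ℝ) ^ 3)]
    have : (N : ℝ) ^ 2 = √(N : ℝ) ^ 4 := by
      rw [show √(N : ℝ) ^ 4 = (√(N : ℝ) ^ 2) ^ 2 by ring, Real.sq_sqrt hN'.le]
    rw [this]
    simp only [hE]
    field_simp
  have herr : Tendsto (fun N : ℕ => (N : ℝ) *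
      (((1 + ε N) ^ N).re - (1 + N * ε N + N * (N - 1) / 2 * ε N ^ 2).re)) atTop (𝓝 0) := by
    have h1 : Tendsto (fun N : ℕ => ((√(N : ℝ) ^ 3 * E N) ^ 3 * (√(N : ℝ))⁻¹) *
        Real.exp (√(N : ℝ) ^ 3 * E N * (√(N : ℝ))⁻¹)) atTop (𝓝 0) := by
      have h := ((hscale.pow 3).mul tendsto_inv_sqrt).mul
        ((hscale.mul tendsto_inv_sqrt).rexp)
      simpa using h
    refine squeeze_zero_norm' ?_ h1
    filter_upwards [eventually_gt_atTop 0] with N hN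
    have hN' : (0 : ℝ) < N := by exact_mod_cast hN
    have hs : 0 < √(N : ℝ) := Real.sqrt_pos.2 hN'
    have h := (Complex.abs_re_le_norm _).trans (norm_one_add_pow_sub_le (ε N) N)
    rw [Complex.sub_re] at h
    rw [Real.norm_eq_abs, abs_mul, Nat.abs_cast]
    have hNs : (N : ℝ) = √(N : ℝ) ^ 2 := (Real.sq_sqrt hN'.le).symm
    have h2 : (1 + ‖ε N‖) ^ N ≤ Real.exp (N * E N) := by
      rw [mul_comm, Real.exp_mul, Real.rpow_natCast]
      refine pow_le_pow_left₀ (by positivity) ?_ N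
      linarith [hεE N, Real.add_one_le_exp (E N)]
    have h3 : ‖ε N‖ ^ 3 ≤ E N ^ 3 := pow_le_pow_left₀ (norm_nonneg _) (hεE N) 3
    calc _ ≤ (N : ℝ) * (N ^ 3 * ‖ε N‖ ^ 3 * (1 + ‖ε N‖) ^ N) :=
          mul_le_mul_of_nonneg_left h hN'.le
      _ ≤ (N : ℝ) * (N ^ 3 * E N ^ 3 * Real.exp (N * E N)) := by gcongr
      _ = (N : ℝ) ^ 4 * E N ^ 3 * Real.exp (N * E N) := by ring
      _ = _ := by
        congr 1
        · have : (N : ℝ) ^ 4 = √(N : ℝ) ^ 8 := by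
            rw [show √(N : ℝ) ^ 8 = (√(N : ℝ) ^ 2) ^ 4 by ring, ← hNs]
          rw [this]
          field_simp
        · congr 1
          have : (N : ℝ) * E N = √(N : ℝ) ^ 2 * E N := by rw [← hNs]
          rw [this]
          field_simp
  have hmain : Tendsto (fun N : ℕ => (N : ℝ) ^ 2 * a N + (1 - (N : ℝ)⁻¹) / 2 *
      (((N : ℝ) ^ 2 * a N) ^ 2 * (N : ℝ)⁻¹ - (√(N : ℝ) ^ 3 * b N) ^ 2)) atTop
      (𝓝 (α - β ^ 2 / 2)) := by
    have h := ha.add ((((tendsto_const_nhds (x := (1 : ℝ))).sub hinv).div_const 2).mul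
      (((ha.pow 2).mul hinv).sub (hb.pow 2)))
    convert h using 2
    ring
  have := herr.add hmain
  rw [zero_add] at this
  refine this.congr' ?_
  filter_upwards [eventually_gt_atTop 0] with N hN
  have hN' : (0 : ℝ) < N := by exact_mod_cast hN
  have e1 : (1 + N * ε N + N * (N - 1) / 2 * ε N ^ 2).re =
      1 + N * a N + N * (N - 1) / 2 * (a N ^ 2 - b N ^ 2) := by
    have e2 : (1 + N * ε N + N * (N - 1) / 2 * ε N ^ 2) =
        ((1 + N * a N + N * (N - 1) / 2 * (a N ^ 2 - b N ^ 2) : ℝ) : ℂ) +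
          ((N * b N + N * (N - 1) * (a N * b N) : ℝ) : ℂ) * Complex.I := by
      simp only [hε]
      push_cast
      linear_combination (N * (N - 1) / 2 * (b N : ℂ) ^ 2) * Complex.I_sq
    rw [e2, Complex.add_re, Complex.ofReal_re, Complex.re_ofReal_mul, Complex.I_re, mul_zero,
      add_zero]
  have e3 : (√(N : ℝ) ^ 3 * b N) ^ 2 = N ^ 3 * b N ^ 2 := by
    rw [mul_pow, show (√(N : ℝ) ^ 3) ^ 2 = (√(N : ℝ) ^ 2) ^ 3 by ring, Real.sq_sqrt hN'.le]
  rw [e1, e3]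
  field_simp
  ring

theorem tendsto_pow_deviation {Q : ℝ} {w : ℕ → ℂ} {α β : ℝ}
    (ha : Tendsto (fun N : ℕ => (N : ℝ) ^ 2 * ((w N).re - Real.exp (-(Q / N)))) atTop (𝓝 α))
    (hb : Tendsto (fun N : ℕ => √(N : ℝ) ^ 3 * (w N).im) atTop (𝓝 β)) :
    Tendsto (fun N : ℕ => (N : ℝ) * ((w N ^ N).re - Real.exp (-Q))) atTop
      (𝓝 (Real.exp (-Q) * (α - β ^ 2 / 2))) := by
  have hq : Tendsto (fun N : ℕ => Real.exp (Q / N)) atTop (𝓝 1) := by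
    have : Tendsto (fun N : ℕ => Q / (N : ℝ)) atTop (𝓝 0) :=
      tendsto_const_nhds.div_atTop tendsto_natCast_atTop_atTop
    simpa using this.rexp
  have ha' := ha.mul hq
  have hb' := hb.mul hq
  rw [mul_one] at ha' hb'
  simp_rw [mul_assoc] at ha' hb'
  have h := (tendsto_mul_one_add_pow_sub_one ha' hb').const_mul (Real.exp (-Q))
  refine h.congr' ?_
  filter_upwards [eventually_gt_atTop 0] with N hN
  have hN' : (N : ℝ) ≠ 0 := by positivity
  have e1 : Real.exp (-(Q / N)) * Real.exp (Q / N) = 1 := by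
    rw [← Real.exp_add, neg_add_cancel, Real.exp_zero]
  have e2 : Real.exp (-(Q / N)) ^ N = Real.exp (-Q) := by
    rw [← Real.exp_nat_mul]
    congr 1
    field_simp
  have e3 : ∀ x y : ℝ, x * y = 1 → w N = (x : ℂ) *
      (1 + (((((w N).re - x) * y : ℝ) : ℂ) + Complex.I * ((w N).im * y : ℝ))) := by
    intro x y hxy
    apply Complex.ext
    · simp
      linear_combination (x - (w N).re) * hxy
    · simp
      linear_combination (-(w N).im) * hxy
  have e4 : (w N ^ N).re = Real.exp (-Q) *
      ((1 + (((((w N).re - Real.exp (-(Q / N))) * Real.exp (Q / N) : ℝ) : ℂ) +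
        Complex.I * ((w N).im * Real.exp (Q / N) : ℝ))) ^ N).re := by
    conv_lhs => rw [e3 _ _ e1, mul_pow, ← Complex.ofReal_pow, e2, Complex.re_ofReal_mul]
  rw [e4]
  ring

theorem integrable_pow_mul_exp_neg_mul_sq {b : ℝ} (hb : 0 < b) (n : ℕ) :
    Integrable fun x : ℝ => x ^ n * Real.exp (-b * x ^ 2) := by
  have := integrable_rpow_mul_exp_neg_mul_sq hb (s := n)
    (lt_of_lt_of_le (by norm_num) n.cast_nonneg)
  simpa only [Real.rpow_natCast] using this

theorem integral_pow_add_two_mul_exp_neg_mul_sq {b : ℝ} (hb : 0 < b) (n : ℕ) :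
    ∫ x : ℝ, x ^ (n + 2) * Real.exp (-b * x ^ 2) =
      (n + 1) / (2 * b) * ∫ x : ℝ, x ^ n * Real.exp (-b * x ^ 2) := by
  have hd : ∀ x : ℝ, HasDerivAt (fun x : ℝ => x ^ (n + 1) * Real.exp (-b * x ^ 2))
      ((n + 1) * (x ^ n * Real.exp (-b * x ^ 2)) -
        2 * b * (x ^ (n + 2) * Real.exp (-b * x ^ 2))) x := by
    intro x
    have h1 := hasDerivAt_pow (n + 1) x
    have h2 := (((hasDerivAt_pow 2 x).const_mul (-b)).exp)
    refine (h1.mul h2).congr_deriv ?_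
    push_cast
    ring
  have i0 := integrable_pow_mul_exp_neg_mul_sq hb n
  have i2 := integrable_pow_mul_exp_neg_mul_sq hb (n + 2)
  have h := integral_eq_zero_of_hasDerivAt_of_integrable hd
    ((i0.const_mul _).sub (i2.const_mul _)) (integrable_pow_mul_exp_neg_mul_sq hb (n + 1))
  rw [integral_sub (i0.const_mul _) (i2.const_mul _), integral_const_mul, integral_const_mul] at h
  rw [div_mul_eq_mul_div, eq_div_iff (by positivity)]
  linarith

/-- The Gaussian density (unnormalized) attached to the quadratic form. -/
noncomputable def gauss (p : ℝ × ℝ) : ℝ := Real.exp (-quadForm p)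

theorem gauss_eq (p : ℝ × ℝ) :
    gauss p = Real.exp (-(1 / 6) * p.1 ^ 2) * Real.exp (-(2 / 45) * p.2 ^ 2) := by
  rw [gauss, quadForm, ← Real.exp_add]
  congr 1
  ring

theorem integrable_monomial_mul_gauss (i j : ℕ) :
    Integrable fun p : ℝ × ℝ => p.1 ^ i * p.2 ^ j * gauss p := by
  have := (integrable_pow_mul_exp_neg_mul_sq (b := 1 / 6) (by norm_num) i).mul_prod
    (integrable_pow_mul_exp_neg_mul_sq (b := 2 / 45) (by norm_num) j)
  refine this.congr (ae_of_all _ fun p => ?_)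
  simp only [gauss_eq]
  ring

theorem integral_monomial_mul_gauss (i j : ℕ) :
    ∫ p : ℝ × ℝ, p.1 ^ i * p.2 ^ j * gauss p =
      (∫ x : ℝ, x ^ i * Real.exp (-(1 / 6) * x ^ 2)) *
        ∫ x : ℝ, x ^ j * Real.exp (-(2 / 45) * x ^ 2) := by
  rw [← integral_prod_mul]
  refine integral_congr_ae (ae_of_all _ fun p => ?_)
  simp only [gauss_eq]
  ring

theorem integrable_gauss : Integrable gauss := by
  simpa using integrable_monomial_mul_gauss 0 0

theorem integral_gauss : ∫ p, gauss p = 3 * π * √15 := by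
  have h := integral_monomial_mul_gauss 0 0
  simp only [pow_zero, one_mul] at h
  rw [h, integral_gaussian, integral_gaussian, ← Real.sqrt_mul (by positivity),
    show π / (1 / 6) * (π / (2 / 45)) = (3 * π) ^ 2 * 15 by ring,
    Real.sqrt_mul (by positivity), Real.sqrt_sq (by positivity)]

/-- The density of the correction of relative order `1 / N` to the Gaussian integral. -/
noncomputable def correction (p : ℝ × ℝ) : ℝ :=
  Real.exp (-quadForm p) * (devRe p - (-(cumThree p / 6)) ^ 2 / 2)

theorem integral_correction : ∫ p, correction p = (3 * π * √15) * (-(472 / 735)) := by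
  have e : ∀ p, correction p = (-1 / 180) * (p.1 ^ 4 * p.2 ^ 0 * gauss p) +
      (4 / 945) * (p.1 ^ 2 * p.2 ^ 2 * gauss p) +
      (-4 / 14175) * (p.1 ^ 0 * p.2 ^ 4 * gauss p) +
      (-2 / 2025) * (p.1 ^ 4 * p.2 ^ 2 * gauss p) +
      (-16 / 127575) * (p.1 ^ 2 * p.2 ^ 4 * gauss p) +
      (-32 / 8037225) * (p.1 ^ 0 * p.2 ^ 6 * gauss p) := by
    intro p
    simp only [correction, devRe, cumThree, momFour, gauss, quadForm]
    ring
  have i := fun (c : ℝ) (j k : ℕ) => (integrable_monomial_mul_gauss j k).const_mul c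
  have iadd : ∀ {f g : ℝ × ℝ → ℝ}, Integrable f → Integrable g →
      Integrable fun p => f p + g p := fun hf hg => hf.add hg
  simp_rw [e]
  rw [integral_add (iadd (iadd (iadd (iadd (i _ _ _) (i _ _ _)) (i _ _ _)) (i _ _ _)) (i _ _ _))
      (i _ _ _),
    integral_add (iadd (iadd (iadd (i _ _ _) (i _ _ _)) (i _ _ _)) (i _ _ _)) (i _ _ _),
    integral_add (iadd (iadd (i _ _ _) (i _ _ _)) (i _ _ _)) (i _ _ _),
    integral_add (iadd (i _ _ _) (i _ _ _)) (i _ _ _), integral_add (i _ _ _) (i _ _ _)]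
  simp only [integral_const_mul, integral_monomial_mul_gauss]
  have hg := integral_gauss
  have h00 := integral_monomial_mul_gauss 0 0
  simp only [pow_zero, one_mul] at h00
  rw [hg] at h00
  have m := fun (b : ℝ) (hb : 0 < b) => integral_pow_add_two_mul_exp_neg_mul_sq hb
  have a2 := m (1 / 6) (by norm_num) 0
  have a4 := m (1 / 6) (by norm_num) 2
  have b2 := m (2 / 45) (by norm_num) 0
  have b4 := m (2 / 45) (by norm_num) 2
  have b6 := m (2 / 45) (by norm_num) 4
  norm_num only at a2 a4 b2 b4 b6
  simp only [pow_zero, one_mul] at a2 b2 ⊢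
  norm_num only at h00 ⊢
  rw [a4, b6, b4, a2, b2, h00]
  ring

theorem rate_pos : 0 < rate := by
  unfold rate
  norm_num

theorem rate_le : rate ≤ 2 / 45 := by
  unfold rate
  norm_num

theorem norm_charFn_le_exp {M : ℕ} (hM : 4 ≤ M) {p : ℝ × ℝ} (hp : p ∈ cell M) :
    ‖charFn M p‖ ≤ Real.exp (-(rate * min 1 (p.1 ^ 2 + p.2 ^ 2))) :=
  (norm_charFn_le hM hp).trans (Real.one_sub_le_exp_neg _)

theorem box_subset_cell {M : ℕ} (hM : 4 ≤ M) : box ⊆ cell M := by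
  rintro p ⟨h1, h2⟩
  have hM' : (4 : ℝ) ≤ M := by exact_mod_cast hM
  have hpi := Real.pi_gt_three
  rw [abs_le] at h1 h2
  have e1 : 12 ≤ π * M := by nlinarith
  have e2 : 48 ≤ π * (M : ℝ) ^ 2 := by nlinarith
  refine ⟨⟨?_, ?_⟩, ⟨?_, ?_⟩⟩ <;> linarith

theorem measurableSet_box : MeasurableSet box := by
  have h1 : IsClosed {p : ℝ × ℝ | |p.1| ≤ 1 / 2} := isClosed_le (by fun_prop) continuous_const
  have h2 : IsClosed {p : ℝ × ℝ | |p.2| ≤ 1 / 2} := isClosed_le (by fun_prop) continuous_const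
  exact (h1.inter h2).measurableSet

theorem measurableSet_cell (M : ℕ) : MeasurableSet (cell M) :=
  measurableSet_Ioc.prod measurableSet_Ioc

theorem measureReal_cell (M : ℕ) : volume.real (cell M) = π ^ 2 * (M : ℝ) ^ 3 / 4 := by
  rw [cell, Measure.volume_eq_prod, measureReal_prod_prod, Real.volume_real_Ioc_of_le,
    Real.volume_real_Ioc_of_le]
  · ring
  · have : 0 ≤ π * (M : ℝ) ^ 2 / 8 := by positivity
    linarith
  · have : 0 ≤ π * (M : ℝ) / 2 := by positivity
    linarith

theorem norm_charFn_le_exp_of_mem_box {M : ℕ} (hM : 4 ≤ M) {p : ℝ × ℝ} (hp : p ∈ box) :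
    ‖charFn M p‖ ≤ Real.exp (-(rate * (p.1 ^ 2 + p.2 ^ 2))) := by
  have h := norm_charFn_le_exp hM (box_subset_cell hM hp)
  rwa [min_eq_right ((norm_sq_le_of_mem_box hp).trans (by norm_num))] at h

theorem lt_of_notMem_box {p : ℝ × ℝ} (hp : p ∉ box) : 1 / 4 < p.1 ^ 2 + p.2 ^ 2 := by
  by_contra! h
  refine hp ⟨abs_le_of_sq_le_sq ?_ (by norm_num), abs_le_of_sq_le_sq ?_ (by norm_num)⟩ <;>
    nlinarith [sq_nonneg p.1, sq_nonneg p.2]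

theorem norm_charFn_le_of_notMem_box {M : ℕ} (hM : 4 ≤ M) {p : ℝ × ℝ} (hp : p ∈ cell M \ box) :
    ‖charFn M p‖ ≤ Real.exp (-(rate / 4)) := by
  refine (norm_charFn_le_exp hM hp.1).trans (Real.exp_le_exp.2 ?_)
  have : 1 / 4 ≤ min 1 (p.1 ^ 2 + p.2 ^ 2) := le_min (by norm_num) (lt_of_notMem_box hp.2).le
  nlinarith [rate_pos]

theorem setIntegral_norm_charFn_pow_le {M : ℕ} (hM : 4 ≤ M) (n : ℕ) :
    ∫ p in cell M \ box, ‖charFn M p‖ ^ n ≤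
      π ^ 2 * (M : ℝ) ^ 3 / 4 * Real.exp (-(rate / 4)) ^ n := by
  have hi : IntegrableOn (fun p => ‖charFn M p‖ ^ n) (cell M) :=
    continuous_integrableOn_cell ((continuous_charFn M).norm.pow n) M
  have hlt : volume (cell M) ≠ ⊤ := by
    rw [cell, Measure.volume_eq_prod, Measure.prod_prod, Real.volume_Ioc, Real.volume_Ioc]
    exact ENNReal.mul_ne_top ENNReal.ofReal_ne_top ENNReal.ofReal_ne_top
  calc ∫ p in cell M \ box, ‖charFn M p‖ ^ n
      ≤ ∫ p in cell M \ box, Real.exp (-(rate / 4)) ^ n := by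
        refine setIntegral_mono_on (hi.mono_set sdiff_subset) ?_
          ((measurableSet_cell M).diff measurableSet_box) fun p hp =>
            pow_le_pow_left₀ (norm_nonneg _) (norm_charFn_le_of_notMem_box hM hp) n
        exact integrableOn_const (ne_top_of_le_ne_top hlt (measure_mono sdiff_subset))
    _ = volume.real (cell M \ box) * Real.exp (-(rate / 4)) ^ n := by
        rw [setIntegral_const, smul_eq_mul]
    _ ≤ _ := by
        rw [← measureReal_cell]
        gcongr
        exact sdiff_subset

theorem tendsto_pow_mul_setIntegral (k : ℕ) :
    Tendsto (fun N : ℕ => (N : ℝ) ^ k * ∫ p in cell (N ^ 3) \ box, ‖charFn (N ^ 3) p‖ ^ (N - 4))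
      atTop (𝓝 0) := by
  have hθ : |Real.exp (-(rate / 4))| < 1 := by
    rw [abs_of_pos (Real.exp_pos _), Real.exp_lt_one_iff]
    linarith [rate_pos]
  have h := ((tendsto_pow_const_mul_const_pow_of_abs_lt_one (k + 9) hθ).const_mul
    (π ^ 2 / 4 * (Real.exp (-(rate / 4)) ^ 4)⁻¹))
  rw [mul_zero] at h
  refine squeeze_zero' (Eventually.of_forall fun N => ?_) ?_ h
  · exact mul_nonneg (by positivity) (integral_nonneg fun p => by positivity)
  · filter_upwards [eventually_ge_atTop 4] with N hN
    have hM : 4 ≤ N ^ 3 := hN.trans (Nat.le_self_pow (by norm_num) N)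
    refine (mul_le_mul_of_nonneg_left (setIntegral_norm_charFn_pow_le hM (N - 4))
      (by positivity)).trans (le_of_eq ?_)
    obtain ⟨n, rfl⟩ := Nat.exists_eq_add_of_le' hN
    have := (Real.exp_pos (-(rate / 4))).ne'
    rw [Nat.add_sub_cancel, pow_add (Real.exp _) n 4, Nat.cast_pow]
    field_simp
    rw [← pow_add]

theorem integral_indicator_box_smul {N : ℕ} (f : ℝ × ℝ → ℝ) :
    ∫ p, box.indicator f ((√(N : ℝ))⁻¹ • p) = N * ∫ p in box, f p := by
  rw [Measure.integral_comp_inv_smul, integral_indicator measurableSet_box]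
  simp

theorem mul_setIntegral_cell {N : ℕ} (hN : 4 ≤ N) {f : ℝ × ℝ → ℝ} (hf : Continuous f) :
    N * ∫ p in cell (N ^ 3), f p =
      (∫ p, box.indicator f ((√(N : ℝ))⁻¹ • p)) + N * ∫ p in cell (N ^ 3) \ box, f p := by
  have hM : 4 ≤ N ^ 3 := hN.trans (Nat.le_self_pow (by norm_num) N)
  have hi : IntegrableOn f (cell (N ^ 3)) := continuous_integrableOn_cell hf _
  rw [integral_indicator_box_smul, ← mul_add, add_comm, setIntegral_sdiff measurableSet_box hi (box_subset_cell hM)]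
  ring

theorem integrable_exp_neg_mul_sq_add_sq {b : ℝ} (hb : 0 < b) :
    Integrable fun p : ℝ × ℝ => Real.exp (-(b * (p.1 ^ 2 + p.2 ^ 2))) := by
  refine ((integrable_exp_neg_mul_sq hb).mul_prod (integrable_exp_neg_mul_sq hb)).congr
    (ae_of_all _ fun p => ?_)
  simp only [← Real.exp_add]
  congr 1
  ring

theorem one_add_pow_four_mul_exp_le {b x : ℝ} (hb : 0 < b) (hx : 0 ≤ x) :
    (1 + x) ^ 4 * Real.exp (-(b * x)) ≤ (1 + 8 / b) ^ 4 * Real.exp (-(b / 2 * x)) := by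
  have h1 : 1 + x ≤ (1 + 8 / b) * Real.exp (b / 8 * x) := by
    have e1 : b / 8 * x + 1 ≤ Real.exp (b / 8 * x) := Real.add_one_le_exp _
    have e2 : x = 8 / b * (b / 8 * x) := by field_simp
    have e3 : 0 ≤ b / 8 * x := by positivity
    have e4 : 0 < 8 / b := by positivity
    nlinarith
  have h2 := pow_le_pow_left₀ (by positivity) h1 4
  have e : Real.exp (-(b / 2 * x)) = Real.exp (b / 8 * x) ^ 4 * Real.exp (-(b * x)) := by
    rw [← Real.exp_nat_mul, ← Real.exp_add]
    congr 1
    push_cast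
    ring
  rw [e, ← mul_assoc, ← mul_pow]
  gcongr

theorem norm_inv_sqrt_smul_sq (N : ℕ) (p : ℝ × ℝ) :
    (((√(N : ℝ))⁻¹ • p).1 ^ 2 + ((√(N : ℝ))⁻¹ • p).2 ^ 2) = (p.1 ^ 2 + p.2 ^ 2) / N := by
  simp only [Prod.smul_fst, Prod.smul_snd, smul_eq_mul, mul_pow, inv_pow,
    Real.sq_sqrt (Nat.cast_nonneg N)]
  ring

theorem norm_charFn_scaled_le {N : ℕ} (hN : 4 ≤ N) {p : ℝ × ℝ}
    (hp : (√(N : ℝ))⁻¹ • p ∈ box) :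
    ‖charFn (N ^ 3) ((√(N : ℝ))⁻¹ • p)‖ ≤ Real.exp (-(rate * (p.1 ^ 2 + p.2 ^ 2) / N)) := by
  have h := norm_charFn_le_exp_of_mem_box (hN.trans (Nat.le_self_pow three_ne_zero N)) hp
  rwa [norm_inv_sqrt_smul_sq, ← mul_div_assoc] at h

theorem exp_neg_div_pow_le {N n : ℕ} (hN : 0 < N) (hn : N ≤ 2 * n) {x : ℝ} (hx : 0 ≤ x) :
    Real.exp (-(x / N)) ^ n ≤ Real.exp (-(x / 2)) := by
  rw [← Real.exp_nat_mul, Real.exp_le_exp]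
  have hN' : (0 : ℝ) < N := by exact_mod_cast hN
  have hn' : (N : ℝ) ≤ 2 * n := by exact_mod_cast hn
  have : x / 2 ≤ n * (x / N) := by
    rw [← mul_div_assoc, div_le_div_iff₀ (by norm_num) hN']
    nlinarith
  linarith

theorem norm_charFn_scaled_pow_le {N n : ℕ} (hN : 4 ≤ N) (hn : N ≤ 2 * n) {p : ℝ × ℝ}
    (hp : (√(N : ℝ))⁻¹ • p ∈ box) :
    ‖charFn (N ^ 3) ((√(N : ℝ))⁻¹ • p)‖ ^ n ≤
      Real.exp (-(rate * (p.1 ^ 2 + p.2 ^ 2) / 2)) :=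
  (pow_le_pow_left₀ (norm_nonneg _) (norm_charFn_scaled_le hN hp) n).trans
    (exp_neg_div_pow_le (by omega) hn (mul_nonneg rate_pos.le (by positivity)))

theorem abs_re_pow_sub_le {w : ℂ} {Q x : ℝ} {N : ℕ} (hN : 4 ≤ N) (hx : 0 ≤ x) (hxQ : x ≤ Q)
    (hw : ‖w‖ ≤ Real.exp (-(x / N))) :
    N * |(w ^ N).re - Real.exp (-Q)| ≤ Real.exp (-(x / 2)) *
      (N ^ 2 * |w.re - Real.exp (-(Q / N))| +
        N ^ 3 * ((w.re - Real.exp (-(Q / N))) ^ 2 + w.im ^ 2)) := by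
  obtain ⟨n, rfl⟩ := Nat.exists_eq_add_of_le' ((by norm_num : 2 ≤ 4).trans hN)
  have hN0 : (0 : ℝ) < (n + 2 : ℕ) := by positivity
  set N : ℕ := n + 2 with hNn
  set q : ℝ := Real.exp (-(Q / N)) with hq
  set δ := w.re - q with hδ
  have hqm : q ≤ Real.exp (-(x / N)) := by
    rw [hq, Real.exp_le_exp]
    have : x / N ≤ Q / N := by gcongr
    linarith
  have hq0 : 0 < q := Real.exp_pos _
  have h := norm_pow_sub_linear_le hw (q := (q : ℂ)) (m := Real.exp (-(x / N)))
    (by rwa [Complex.norm_real, Real.norm_of_nonneg hq0.le]) n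
  have hqN : q ^ N = Real.exp (-Q) := by
    rw [hq, ← Real.exp_nat_mul]
    congr 1
    field_simp
  have hre : (w ^ (n + 2) - (q : ℂ) ^ (n + 2) - (n + 2) * (q : ℂ) ^ (n + 1) * (w - q)).re =
      (w ^ N).re - Real.exp (-Q) - N * q ^ (n + 1) * δ := by
    rw [← hqN, hNn]
    have e : ((n : ℂ) + 2) * (q : ℂ) ^ (n + 1) = ((((n + 2 : ℕ) : ℝ) * q ^ (n + 1) : ℝ) : ℂ) := by
      push_cast
      ring
    rw [e, Complex.sub_re, Complex.sub_re, Complex.re_ofReal_mul, ← Complex.ofReal_pow,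
      Complex.ofReal_re, Complex.sub_re, Complex.ofReal_re]
  have hnorm : ‖w - q‖ ^ 2 = δ ^ 2 + w.im ^ 2 := by
    rw [← Complex.normSq_eq_norm_sq, Complex.normSq_apply]
    simp
    ring
  have h1 := (Complex.abs_re_le_norm _).trans h
  rw [hre, hnorm] at h1
  have hm : Real.exp (-(x / N)) ^ n ≤ Real.exp (-(x / 2)) :=
    exp_neg_div_pow_le (by omega) (by omega) hx
  have hm' : q ^ (n + 1) ≤ Real.exp (-(x / 2)) :=
    (pow_le_pow_left₀ hq0.le hqm _).trans (exp_neg_div_pow_le (by omega) (by omega) hx)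
  have hcast : ((n : ℝ) + 2) = N := by rw [hNn]; push_cast; ring
  rw [hcast] at h1
  have h2 : |N * q ^ (n + 1) * δ| ≤ N * Real.exp (-(x / 2)) * |δ| := by
    rw [abs_mul, abs_of_nonneg (by positivity)]
    gcongr
  have h3 : (N : ℝ) ^ 2 * (δ ^ 2 + w.im ^ 2) * Real.exp (-(x / N)) ^ n ≤
      N ^ 2 * (δ ^ 2 + w.im ^ 2) * Real.exp (-(x / 2)) := by gcongr
  have h4 : |(w ^ N).re - Real.exp (-Q)| ≤ N ^ 2 * (δ ^ 2 + w.im ^ 2) * Real.exp (-(x / 2)) +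
      N * Real.exp (-(x / 2)) * |δ| := by
    have := abs_sub_abs_le_abs_sub ((w ^ N).re - Real.exp (-Q)) (N * q ^ (n + 1) * δ)
    linarith
  calc (N : ℝ) * |(w ^ N).re - Real.exp (-Q)|
      ≤ N * (N ^ 2 * (δ ^ 2 + w.im ^ 2) * Real.exp (-(x / 2)) +
        N * Real.exp (-(x / 2)) * |δ|) := by gcongr
    _ = _ := by ring

/-- The rescaled major-arc deviation of the `N`-th power from the Gaussian. -/
noncomputable def deviation (N : ℕ) (p : ℝ × ℝ) : ℝ :=
  N * (box.indicator (fun z => (charFn (N ^ 3) z ^ N).re) ((√(N : ℝ))⁻¹ • p) - gauss p)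

theorem abs_deviation_le {N : ℕ} (hN : 4 ≤ N) (p : ℝ × ℝ) :
    |deviation N p| ≤
      30 * ((1 + (p.1 ^ 2 + p.2 ^ 2)) ^ 4 * Real.exp (-(rate / 2 * (p.1 ^ 2 + p.2 ^ 2)))) := by
  have hN0 : (0 : ℝ) < N := by exact_mod_cast (by omega : 0 < N)
  have hN4 : (4 : ℝ) ≤ N := by exact_mod_cast hN
  have hr := rate_pos
  have hQ := (mul_le_mul_of_nonneg_right rate_le (by positivity)).trans (le_quadForm p)
  have hQt : quadForm ((√(N : ℝ))⁻¹ • p) = quadForm p / N := by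
    rw [quadForm_smul, inv_pow, Real.sq_sqrt hN0.le]
    ring
  have hsc := norm_inv_sqrt_smul_sq N p
  have hρ : 0 ≤ p.1 ^ 2 + p.2 ^ 2 := by positivity
  have hM : N ^ 3 ≠ 0 := by positivity
  rw [deviation, abs_mul, Nat.abs_cast]
  by_cases hp : (√(N : ℝ))⁻¹ • p ∈ box
  · rw [indicator_of_mem hp]
    have hw := norm_charFn_scaled_le hN hp
    have hre := abs_re_charFn_sub_le hM hp
    have him := im_charFn_sq_le hM ((√(N : ℝ))⁻¹ • p)
    rw [hsc] at him hre
    rw [hQt] at hre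
    have h := abs_re_pow_sub_le hN (mul_nonneg hr.le hρ) hQ hw
    refine h.trans ?_
    generalize charFn (N ^ 3) ((√(N : ℝ))⁻¹ • p) = w at *
    generalize p.1 ^ 2 + p.2 ^ 2 = ρ at *
    generalize w.re - Real.exp (-(quadForm p / N)) = δ at *
    have e1 : (N : ℝ) ^ 2 * |δ| ≤ ρ ^ 2 + 5 * ρ := by
      calc (N : ℝ) ^ 2 * |δ| ≤ N ^ 2 * ((ρ / N) ^ 2 + 5 * (ρ / N) / (N ^ 3 : ℕ)) := by gcongr
        _ = ρ ^ 2 + 5 * ρ / N ^ 2 := by push_cast; field_simp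
        _ ≤ ρ ^ 2 + 5 * ρ := by
          gcongr
          exact div_le_self (by positivity) (by nlinarith)
    have e2 : (N : ℝ) ^ 3 * w.im ^ 2 ≤ ρ ^ 3 := by
      calc (N : ℝ) ^ 3 * w.im ^ 2 ≤ N ^ 3 * (ρ / N) ^ 3 := by gcongr
        _ = ρ ^ 3 := by field_simp
    have e3 : (N : ℝ) ^ 3 * δ ^ 2 ≤ (ρ ^ 2 + 5 * ρ) ^ 2 / 4 := by
      have f1 := pow_le_pow_left₀ (by positivity) e1 2
      have f2 : ((N : ℝ) ^ 2 * |δ|) ^ 2 = N * (N ^ 3 * δ ^ 2) := by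
        rw [mul_pow, sq_abs]
        ring
      have f3 : 0 ≤ (N : ℝ) ^ 3 * δ ^ 2 := by positivity
      nlinarith
    have e4 : (N : ℝ) ^ 2 * |δ| + N ^ 3 * (δ ^ 2 + w.im ^ 2) ≤ 30 * (1 + ρ) ^ 4 := by
      nlinarith [pow_nonneg hρ 2, pow_nonneg hρ 3, pow_nonneg hρ 4]
    rw [← mul_assoc, mul_comm, show rate / 2 * ρ = rate * ρ / 2 by ring]
    gcongr
  · rw [indicator_of_notMem hp, zero_sub, abs_neg, gauss, abs_of_pos (Real.exp_pos _)]
    have h1 := lt_of_notMem_box hp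
    rw [hsc] at h1
    generalize p.1 ^ 2 + p.2 ^ 2 = ρ at *
    rw [lt_div_iff₀ hN0] at h1
    rw [← mul_assoc]
    have e2 : (N : ℝ) ≤ 30 * (1 + ρ) ^ 4 := by
      nlinarith [pow_nonneg hρ 2, pow_nonneg hρ 3, pow_nonneg hρ 4]
    gcongr
    nlinarith

/-- An integrable majorant of the rescaled deviations. -/
noncomputable def majorant (p : ℝ × ℝ) : ℝ :=
  30 * ((1 + 8 / (rate / 2)) ^ 4 * Real.exp (-(rate / 2 / 2 * (p.1 ^ 2 + p.2 ^ 2))))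

theorem integrable_majorant : Integrable majorant :=
  ((integrable_exp_neg_mul_sq_add_sq (half_pos (half_pos rate_pos))).const_mul _).const_mul _

theorem measurable_indicator_box_smul {f : ℝ × ℝ → ℝ} (hf : Continuous f) (t : ℝ) :
    Measurable fun p : ℝ × ℝ => box.indicator f (t • p) :=
  (hf.measurable.indicator measurableSet_box).comp (measurable_const_smul t)

theorem eventually_inv_sqrt_smul_mem_box (p : ℝ × ℝ) :
    ∀ᶠ N : ℕ in atTop, (√(N : ℝ))⁻¹ • p ∈ box := by
  filter_upwards [eventually_abs_add_le p] with N hN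
  have h := hN.1.le.trans hN.2.1
  exact ⟨by linarith [abs_nonneg ((√(N : ℝ))⁻¹ • p).2],
    by linarith [abs_nonneg ((√(N : ℝ))⁻¹ • p).1]⟩

theorem tendsto_deviation (p : ℝ × ℝ) :
    Tendsto (fun N => deviation N p) atTop (𝓝 (correction p)) := by
  refine (tendsto_pow_deviation (tendsto_re_deviation p) (tendsto_im_deviation p)).congr' ?_
  filter_upwards [eventually_inv_sqrt_smul_mem_box p] with N hN
  rw [deviation, indicator_of_mem hN, gauss]

theorem measurable_deviation (N : ℕ) : Measurable (deviation N) := by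
  have h1 : Measurable gauss := by
    unfold gauss quadForm
    fun_prop
  refine ((measurable_indicator_box_smul ?_ _).sub h1).const_mul _
  exact Complex.continuous_re.comp ((continuous_charFn _).pow _)

theorem norm_deviation_le {N : ℕ} (hN : 4 ≤ N) (p : ℝ × ℝ) : ‖deviation N p‖ ≤ majorant p := by
  refine (abs_deviation_le hN p).trans ?_
  refine mul_le_mul_of_nonneg_left ?_ (by norm_num)
  exact one_add_pow_four_mul_exp_le (half_pos rate_pos) (add_nonneg (sq_nonneg _) (sq_nonneg _))

theorem tendsto_integral_deviation :
    Tendsto (fun N => ∫ p, deviation N p) atTop (𝓝 (3 * π * √15 * (-(472 / 735)))) := by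
  rw [← integral_correction]
  refine tendsto_integral_filter_of_dominated_convergence majorant
    (Eventually.of_forall fun N => (measurable_deviation N).aestronglyMeasurable) ?_
    integrable_majorant (ae_of_all _ tendsto_deviation)
  filter_upwards [eventually_ge_atTop 4] with N hN
  exact ae_of_all _ (norm_deviation_le hN)

theorem abs_setIntegral_sdiff_le {N : ℕ} {f : ℝ × ℝ → ℝ} {C : ℝ}
    (hb : ∀ p, |f p| ≤ C * ‖charFn (N ^ 3) p‖ ^ (N - 4)) :
    |∫ p in cell (N ^ 3) \ box, f p| ≤
      C * ∫ p in cell (N ^ 3) \ box, ‖charFn (N ^ 3) p‖ ^ (N - 4) := by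
  have hi : IntegrableOn (fun p => ‖charFn (N ^ 3) p‖ ^ (N - 4)) (cell (N ^ 3) \ box) :=
    (continuous_integrableOn_cell ((continuous_charFn _).norm.pow _) _).mono_set sdiff_subset
  rw [← integral_const_mul]
  exact norm_integral_le_of_norm_le (f := f) (hi.const_mul C) (ae_of_all _ hb)

theorem tendsto_pow_mul_setIntegral_sdiff (k : ℕ) {f : ℕ → ℝ × ℝ → ℝ} {C : ℝ}
    (hb : ∀ N, 4 ≤ N → ∀ p, |f N p| ≤ C * ‖charFn (N ^ 3) p‖ ^ (N - 4)) :
    Tendsto (fun N : ℕ => (N : ℝ) ^ k * ∫ p in cell (N ^ 3) \ box, f N p) atTop (𝓝 0) := by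
  have h := (tendsto_pow_mul_setIntegral k).const_mul C
  rw [mul_zero] at h
  refine squeeze_zero_norm' ?_ h
  filter_upwards [eventually_ge_atTop 4] with N hN
  rw [norm_mul, Real.norm_of_nonneg (by positivity), mul_left_comm]
  gcongr
  exact abs_setIntegral_sdiff_le (hb N hN)

theorem abs_re_charFn_pow_le {N : ℕ} (p : ℝ × ℝ) :
    |(charFn (N ^ 3) p ^ N).re| ≤ 1 * ‖charFn (N ^ 3) p‖ ^ (N - 4) := by
  rw [one_mul]
  refine (Complex.abs_re_le_norm _).trans ?_
  rw [norm_pow]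
  exact pow_le_pow_of_le_one (norm_nonneg _) (norm_charFn_le_one _ _) (Nat.sub_le _ _)

theorem tendsto_integral_re_charFn_pow :
    Tendsto (fun N : ℕ => (N : ℝ) *
      (N * (∫ p in cell (N ^ 3), (charFn (N ^ 3) p ^ N).re) - 3 * π * √15)) atTop
      (𝓝 (3 * π * √15 * (-(472 / 735)))) := by
  have h := tendsto_integral_deviation.add
    (tendsto_pow_mul_setIntegral_sdiff 2 fun N _ => abs_re_charFn_pow_le (N := N))
  rw [add_zero] at h
  refine h.congr' ?_
  filter_upwards [eventually_ge_atTop 4] with N hN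
  have hN0 : (N : ℝ) ≠ 0 := by positivity
  have hc : Continuous fun p => (charFn (N ^ 3) p ^ N).re :=
    Complex.continuous_re.comp ((continuous_charFn _).pow _)
  have hi : Integrable (deviation N) :=
    integrable_majorant.mono' (measurable_deviation N).aestronglyMeasurable
      (ae_of_all _ (norm_deviation_le hN))
  have hind : Integrable fun p : ℝ × ℝ =>
      box.indicator (fun z => (charFn (N ^ 3) z ^ N).re) ((√(N : ℝ))⁻¹ • p) := by
    refine ((hi.const_mul (N : ℝ)⁻¹).add integrable_gauss).congr (ae_of_all _ fun p => ?_)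
    simp only [Pi.add_apply, deviation]
    field_simp
    ring
  have he : ∫ p, deviation N p = N * ((∫ p : ℝ × ℝ,
      box.indicator (fun z => (charFn (N ^ 3) z ^ N).re) ((√(N : ℝ))⁻¹ • p)) - 3 * π * √15) := by
    rw [← integral_gauss, ← integral_sub hind integrable_gauss, ← integral_const_mul]
    rfl
  rw [he, mul_setIntegral_cell hN hc]
  ring

theorem tendsto_mul_integral_re_charFn_pow :
    Tendsto (fun N : ℕ => N * ∫ p in cell (N ^ 3), (charFn (N ^ 3) p ^ N).re) atTop
      (𝓝 (3 * π * √15)) := by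
  have h := (tendsto_integral_re_charFn_pow.mul
    (tendsto_inv_atTop_nhds_zero_nat (𝕜 := ℝ))).add_const (3 * π * √15)
  rw [mul_zero, zero_add] at h
  refine h.congr' ?_
  filter_upwards [eventually_ne_atTop 0] with N hN
  have hN0 : (N : ℝ) ≠ 0 := by exact_mod_cast hN
  field_simp
  ring

theorem abs_indicator_box_le {N : ℕ} (hN : 8 ≤ N) {f : ℝ × ℝ → ℝ} {C : ℝ} (hC : 0 ≤ C)
    (hb : ∀ p, |f p| ≤ C * ‖charFn (N ^ 3) p‖ ^ (N - 4)) (p : ℝ × ℝ) :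
    ‖box.indicator f ((√(N : ℝ))⁻¹ • p)‖ ≤
      C * Real.exp (-(rate / 2 * (p.1 ^ 2 + p.2 ^ 2))) := by
  by_cases hp : (√(N : ℝ))⁻¹ • p ∈ box
  · rw [indicator_of_mem hp, div_mul_eq_mul_div]
    refine (hb _).trans ?_
    gcongr
    exact norm_charFn_scaled_pow_le (by omega) (by omega) hp
  · rw [indicator_of_notMem hp, norm_zero]
    positivity

theorem tendsto_mul_setIntegral_cell_zero {f : ℕ → ℝ × ℝ → ℝ} {C : ℝ} (hC : 0 ≤ C)
    (hf : ∀ N, Continuous (f N))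
    (hb : ∀ N, 4 ≤ N → ∀ p, |f N p| ≤ C * ‖charFn (N ^ 3) p‖ ^ (N - 4))
    (h0 : ∀ p, Tendsto (fun N : ℕ => f N ((√(N : ℝ))⁻¹ • p)) atTop (𝓝 0)) :
    Tendsto (fun N : ℕ => N * ∫ p in cell (N ^ 3), f N p) atTop (𝓝 0) := by
  have h1 : Tendsto (fun N : ℕ => ∫ p, box.indicator (f N) ((√(N : ℝ))⁻¹ • p)) atTop
      (𝓝 (∫ p : ℝ × ℝ, (0 : ℝ))) := by
    refine tendsto_integral_filter_of_dominated_convergence _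
      (Eventually.of_forall fun N => (measurable_indicator_box_smul (hf N) _).aestronglyMeasurable)
      ?_ ((integrable_exp_neg_mul_sq_add_sq (half_pos rate_pos)).const_mul C)
      (ae_of_all _ fun p => ?_)
    · filter_upwards [eventually_ge_atTop 8] with N hN
      exact ae_of_all _ (abs_indicator_box_le hN hC (hb N (by omega)))
    · refine (h0 p).congr' ?_
      filter_upwards [eventually_inv_sqrt_smul_mem_box p] with N hN
      rw [indicator_of_mem hN]
  have h := h1.add (tendsto_pow_mul_setIntegral_sdiff 1 hb)
  rw [integral_zero, add_zero] at h
  refine h.congr' ?_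
  filter_upwards [eventually_ge_atTop 4] with N hN
  rw [mul_setIntegral_cell hN (hf N), pow_one]

theorem norm_charFn_sub_one_le {M : ℕ} (hM : M ≠ 0) (p : ℝ × ℝ) :
    ‖charFn M p - 1‖ ≤ |p.1| + |p.2| := by
  have hM0 : (M : ℂ) ≠ 0 := by exact_mod_cast hM
  have hMpos : (0 : ℝ) < M := by positivity
  have e : charFn M p - 1 = (∑ k ∈ Finset.range M, (chi M p k - 1)) / M := by
    rw [charFn, Finset.sum_sub_distrib, sub_div]
    simp [hM0]
  rw [e, norm_div, Complex.norm_natCast, div_le_iff₀ hMpos]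
  refine (norm_sum_le_of_le _ fun k hk => ?_).trans
    (le_of_eq (by rw [Finset.sum_const, Finset.card_range, nsmul_eq_mul, mul_comm]))
  exact (Real.norm_exp_I_mul_ofReal_sub_one_le).trans (abs_phase_le (Finset.mem_range.1 hk) p)

theorem tendsto_charFn_inv_sqrt_smul (p : ℝ × ℝ) :
    Tendsto (fun N : ℕ => charFn (N ^ 3) ((√(N : ℝ))⁻¹ • p)) atTop (𝓝 1) := by
  rw [tendsto_iff_norm_sub_tendsto_zero]
  have h := tendsto_inv_sqrt.mul_const (|p.1| + |p.2|)
  rw [zero_mul] at h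
  refine squeeze_zero' (Eventually.of_forall fun N => norm_nonneg _) ?_ h
  filter_upwards [eventually_abs_add_le p] with N hN
  rw [← hN.1]
  exact norm_charFn_sub_one_le (pow_ne_zero 3 hN.2.2) _

theorem tendsto_mul_integral_charFn_two_smul :
    Tendsto (fun N : ℕ => N * ∫ p in cell (N ^ 3),
      (charFn (N ^ 3) ((2 : ℝ) • p) * charFn (N ^ 3) p ^ (N - 2)).re) atTop
      (𝓝 (3 * π * √15)) := by
  have hc2 : ∀ N : ℕ, Continuous fun p => charFn (N ^ 3) ((2 : ℝ) • p) := fun N =>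
    (continuous_charFn _).comp (continuous_const_smul 2)
  have hc : ∀ N : ℕ, Continuous fun p =>
      (charFn (N ^ 3) ((2 : ℝ) • p) * charFn (N ^ 3) p ^ (N - 2)).re := fun N =>
    Complex.continuous_re.comp ((hc2 N).mul ((continuous_charFn _).pow _))
  have hc' : ∀ N : ℕ, Continuous fun p => (charFn (N ^ 3) p ^ N).re := fun N =>
    Complex.continuous_re.comp ((continuous_charFn _).pow _)
  have hle : ∀ N, 2 ≤ N → ∀ p,
      |(charFn (N ^ 3) ((2 : ℝ) • p) * charFn (N ^ 3) p ^ (N - 2)).re - (charFn (N ^ 3) p ^ N).re| ≤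
        ‖charFn (N ^ 3) ((2 : ℝ) • p) - charFn (N ^ 3) p ^ 2‖ * ‖charFn (N ^ 3) p‖ ^ (N - 2) := by
    intro N hN p
    rw [← Complex.sub_re, ← norm_pow, ← norm_mul, sub_mul, ← pow_add, Nat.add_sub_cancel' hN]
    exact Complex.abs_re_le_norm _
  have h := tendsto_mul_setIntegral_cell_zero (C := 2) (by norm_num)
    (fun N => (hc N).sub (hc' N)) (fun N hN p => ?_) (fun p => ?_)
  · have h' := h.add tendsto_mul_integral_re_charFn_pow
    rw [zero_add] at h'
    refine h'.congr fun N => ?_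
    rw [integral_sub' (continuous_integrableOn_cell (hc N) _)
      (continuous_integrableOn_cell (hc' N) _)]
    ring
  · refine (hle N (by omega) p).trans ?_
    have h1 : ‖charFn (N ^ 3) ((2 : ℝ) • p) - charFn (N ^ 3) p ^ 2‖ ≤ 2 := by
      refine (norm_sub_le _ _).trans ?_
      rw [norm_pow]
      have := norm_charFn_le_one (N ^ 3) ((2 : ℝ) • p)
      have := pow_le_one₀ (norm_nonneg _) (norm_charFn_le_one (N ^ 3) p) (n := 2)
      linarith
    gcongr ?_ * ?_
    exact pow_le_pow_of_le_one (norm_nonneg _) (norm_charFn_le_one _ _) (by omega)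
  · have h2 := tendsto_charFn_inv_sqrt_smul ((2 : ℝ) • p)
    have h3 := (h2.sub ((tendsto_charFn_inv_sqrt_smul p).pow 2)).norm
    rw [one_pow, sub_self, norm_zero] at h3
    refine squeeze_zero_norm' ?_ h3
    filter_upwards [eventually_ge_atTop 2] with N hN
    refine (hle N hN _).trans ?_
    rw [smul_comm (2 : ℝ)]
    exact mul_le_of_le_one_right (norm_nonneg _)
      (pow_le_one₀ (norm_nonneg _) (norm_charFn_le_one _ _))

theorem exists_mul_integral_norm_charFn_le : ∃ C : ℝ, ∀ᶠ N : ℕ in atTop,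
    N * ∫ p in cell (N ^ 3), ‖charFn (N ^ 3) p‖ ^ (N - 4) ≤ C := by
  have hb : ∀ N : ℕ, ∀ p, |‖charFn (N ^ 3) p‖ ^ (N - 4)| ≤ 1 * ‖charFn (N ^ 3) p‖ ^ (N - 4) :=
    fun N p => by rw [one_mul, abs_of_nonneg (by positivity)]
  refine ⟨(∫ p : ℝ × ℝ, 1 * Real.exp (-(rate / 2 * (p.1 ^ 2 + p.2 ^ 2)))) + 1, ?_⟩
  filter_upwards [eventually_ge_atTop 8, (tendsto_pow_mul_setIntegral 1).eventually
    (ge_mem_nhds one_pos)] with N hN h1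
  have hc : Continuous fun p => ‖charFn (N ^ 3) p‖ ^ (N - 4) := (continuous_charFn _).norm.pow _
  rw [mul_setIntegral_cell (by omega) hc]
  rw [pow_one] at h1
  refine add_le_add ((le_abs_self _).trans ?_) h1
  exact norm_integral_le_of_norm_le
    ((integrable_exp_neg_mul_sq_add_sq (half_pos rate_pos)).const_mul 1)
    (ae_of_all _ (abs_indicator_box_le hN zero_le_one (hb N)))

section Counts

open scoped Classical

theorem re_integral_cell {M : ℕ} {f : ℝ × ℝ → ℂ} (hf : Continuous f) :
    (∫ p in cell M, f p).re = ∫ p in cell M, (f p).re :=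
  (integral_re (continuous_integrableOn_cell hf M)).symm

theorem card_balanced_real {N : ℕ} (hN : N ≠ 0) :
    ((Finset.univ.filter (IsBalanced (N := N) (M := N ^ 3))).card : ℝ) *
        (π ^ 2 * (N : ℝ) ^ 9 / 4) =
      ((N : ℝ) ^ 3) ^ N * ∫ p in cell (N ^ 3), (charFn (N ^ 3) p ^ N).re := by
  have hc : Continuous fun p => charFn (N ^ 3) p ^ N := (continuous_charFn _).pow _
  have h := congrArg Complex.re (card_balanced hN)
  have e1 : (π ^ 2 * (N : ℂ) ^ 9 / 4) = ((π ^ 2 * (N : ℝ) ^ 9 / 4 : ℝ) : ℂ) := by push_cast; rfl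
  have e2 : ((N : ℂ) ^ 3) ^ N = ((((N : ℝ) ^ 3) ^ N : ℝ) : ℂ) := by push_cast; rfl
  rwa [e1, e2, Complex.re_mul_ofReal, Complex.natCast_re, Complex.re_ofReal_mul,
    re_integral_cell hc] at h

theorem card_balanced_eq_real {N : ℕ} {i j : Fin N} (hij : i ≠ j) :
    (((Finset.univ.filter (IsBalanced (N := N) (M := N ^ 3))).filter fun f => f i = f j).card : ℝ) *
        (π ^ 2 * (N : ℝ) ^ 9 / 4) =
      ((N : ℝ) ^ 3) ^ (N - 1) * ∫ p in cell (N ^ 3),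
        (charFn (N ^ 3) ((2 : ℝ) • p) * charFn (N ^ 3) p ^ (N - 2)).re := by
  have hc : Continuous fun p => charFn (N ^ 3) ((2 : ℝ) • p) * charFn (N ^ 3) p ^ (N - 2) :=
    ((continuous_charFn _).comp (continuous_const_smul 2)).mul ((continuous_charFn _).pow _)
  have h := congrArg Complex.re (card_balanced_eq hij)
  have e1 : (π ^ 2 * (N : ℂ) ^ 9 / 4) = ((π ^ 2 * (N : ℝ) ^ 9 / 4 : ℝ) : ℂ) := by push_cast; rfl
  have e2 : ((N : ℂ) ^ 3) ^ (N - 1) = ((((N : ℝ) ^ 3) ^ (N - 1) : ℝ) : ℂ) := by push_cast; rfl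
  rw [Finset.filter_comm]
  rwa [e1, e2, Complex.re_mul_ofReal, Complex.natCast_re, Complex.re_ofReal_mul,
    re_integral_cell hc] at h

/-- The normalized number of balanced injective tuples. -/
noncomputable def normalizedCount (N : ℕ) : ℝ :=
  N * (π ^ 2 * (N : ℝ) ^ 9 / 4) * (bimagicCubeSeries N * N.factorial : ℕ) / ((N : ℝ) ^ 3) ^ N

theorem abs_normalizedCount_sub_le {N : ℕ} (hN : 2 ≤ N) :
    |normalizedCount N - N * (∫ p in cell (N ^ 3), (charFn (N ^ 3) p ^ N).re) +
        N.choose 2 / (N : ℝ) ^ 3 * (N * ∫ p in cell (N ^ 3),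
          (charFn (N ^ 3) ((2 : ℝ) • p) * charFn (N ^ 3) p ^ (N - 2)).re)| ≤
      ((N.choose 2 : ℝ) / (N : ℝ) ^ 3) ^ 2 *
        (N * ∫ p in cell (N ^ 3), ‖charFn (N ^ 3) p‖ ^ (N - 4)) := by
  rw [normalizedCount]
  set U := Finset.univ.filter (IsBalanced (N := N) (M := N ^ 3)) with hU
  set K : ℝ := π ^ 2 * (N : ℝ) ^ 9 / 4 with hK
  set A := ∫ p in cell (N ^ 3), (charFn (N ^ 3) p ^ N).re with hA
  set B := ∫ p in cell (N ^ 3),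
    (charFn (N ^ 3) ((2 : ℝ) • p) * charFn (N ^ 3) p ^ (N - 2)).re with hB
  set J := ∫ p in cell (N ^ 3), ‖charFn (N ^ 3) p‖ ^ (N - 4) with hJ
  obtain ⟨C, hC⟩ : ∃ C : ℝ, C = N.choose 2 := ⟨_, rfl⟩
  rw [← hC]
  set M : ℝ := (N : ℝ) ^ 3 with hM
  have hN0 : (0 : ℝ) < N := by exact_mod_cast (by omega : 0 < N)
  have hM0 : 0 < M := by positivity
  have hK0 : 0 < K := by positivity
  have hJ0 : 0 ≤ J := integral_nonneg fun p => by positivity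
  have hD : (U.filter fun f => f.Injective).card = bimagicCubeSeries N * N.factorial := by
    rw [← card_balanced_injective (by omega), hU, Finset.filter_filter]
  have h := abs_card_injective_sub_le U
  rw [hD] at h
  have h1 : (U.card : ℝ) * K = M ^ N * A := card_balanced_real (by omega)
  have h2 : (∑ q ∈ indexPairs N, ((U.filter fun f => f q.1 = f q.2).card : ℝ)) * K =
      C * (M ^ (N - 1) * B) := by
    rw [Finset.sum_mul, Finset.sum_congr rfl fun q hq =>
      card_balanced_eq_real (Finset.mem_filter.1 hq).2.ne, Finset.sum_const, card_indexPairs,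
      nsmul_eq_mul, ← hC]
  have h3 : (∑ r ∈ (indexPairs N).offDiag,
      ((U.filter fun f => f r.1.1 = f r.1.2 ∧ f r.2.1 = f r.2.2).card : ℝ)) * K ≤
      C ^ 2 * (M ^ (N - 2) * J) := by
    rw [Finset.sum_mul]
    refine (Finset.sum_le_card_nsmul _ _ (M ^ (N - 2) * J) fun r hr => ?_).trans ?_
    · obtain ⟨hr1, hr2, hr3⟩ := Finset.mem_offDiag.1 hr
      rw [hU, Finset.filter_comm]
      exact card_balanced_eq_eq_le (Finset.mem_filter.1 hr1).2 (Finset.mem_filter.1 hr2).2 hr3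
    · rw [nsmul_eq_mul]
      have : ((indexPairs N).offDiag.card : ℝ) ≤ C ^ 2 := by
        rw [hC, ← card_indexPairs, sq]
        exact_mod_cast (Finset.offDiag_card _).le.trans (Nat.sub_le _ _)
      gcongr
  generalize (∑ r ∈ (indexPairs N).offDiag,
    ((U.filter fun f => f r.1.1 = f r.1.2 ∧ f r.2.1 = f r.2.2).card : ℝ)) = R at h h3
  generalize (∑ q ∈ indexPairs N, ((U.filter fun f => f q.1 = f q.2).card : ℝ)) = T at h h2
  generalize ((bimagicCubeSeries N * N.factorial : ℕ) : ℝ) = D at h ⊢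
  obtain ⟨n, rfl⟩ := Nat.exists_eq_add_of_le' hN
  rw [show n + 2 - 1 = n + 1 by omega] at h2
  rw [Nat.add_sub_cancel] at h3
  clear_value K A B J M
  generalize ((n + 2 : ℕ) : ℝ) = x at *
  have e : x * K * D / M ^ (n + 2) - x * A + C / M * (x * B) =
      x * K / M ^ (n + 2) * (D - U.card + T) := by
    have hA' : A = U.card * K / M ^ (n + 2) := by rw [h1]; field_simp
    have hB' : C * B = T * K / M ^ (n + 1) := by rw [h2]; field_simp
    rw [show C / M * (x * B) = x * (C * B) / M by ring, hA', hB']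
    field_simp
    ring
  rw [e, abs_mul, abs_of_pos (by positivity)]
  calc x * K / M ^ (n + 2) * |D - U.card + T| ≤ x * K / M ^ (n + 2) * R := by gcongr
    _ = x / M ^ (n + 2) * (R * K) := by ring
    _ ≤ x / M ^ (n + 2) * (C ^ 2 * (M ^ n * J)) := by gcongr
    _ = _ := by
      field_simp
      ring

end Counts

theorem tendsto_normalizedCount :
    Tendsto (fun N : ℕ => (N : ℝ) * (normalizedCount N - 3 * π * √15)) atTop
      (𝓝 (3 * π * √15 * (-(472 / 735) - 1 / 2))) := by
  have hinv := tendsto_inv_atTop_nhds_zero_nat (𝕜 := ℝ)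
  obtain ⟨C, hC⟩ := exists_mul_integral_norm_charFn_le
  have hc : Tendsto (fun N : ℕ => (N : ℝ) * (N.choose 2 / (N : ℝ) ^ 3)) atTop (𝓝 (1 / 2)) := by
    have h : Tendsto (fun N : ℕ => (1 - (N : ℝ)⁻¹) / 2) atTop (𝓝 ((1 - 0) / 2)) :=
      (tendsto_const_nhds.sub hinv).div_const 2
    rw [sub_zero] at h
    refine h.congr' ?_
    filter_upwards [eventually_ne_atTop 0] with N hN
    have hN0 : (N : ℝ) ≠ 0 := by exact_mod_cast hN
    rw [Nat.cast_choose_two]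
    field_simp
  have hr : Tendsto (fun N : ℕ => (N : ℝ)⁻¹ * ((N : ℝ) * (N.choose 2 / (N : ℝ) ^ 3)) ^ 2 * C)
      atTop (𝓝 0) := by
    have := (hinv.mul (hc.pow 2)).mul_const C
    rwa [zero_mul, zero_mul] at this
  have hd : Tendsto (fun N : ℕ => (N : ℝ) * (normalizedCount N -
      N * (∫ p in cell (N ^ 3), (charFn (N ^ 3) p ^ N).re) +
        N.choose 2 / (N : ℝ) ^ 3 * (N * ∫ p in cell (N ^ 3),
          (charFn (N ^ 3) ((2 : ℝ) • p) * charFn (N ^ 3) p ^ (N - 2)).re))) atTop (𝓝 0) := by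
    refine squeeze_zero_norm' ?_ hr
    filter_upwards [hC, eventually_ge_atTop 2] with N hN h2
    have hN0 : (0 : ℝ) < N := by exact_mod_cast (by omega : 0 < N)
    rw [norm_mul, Real.norm_of_nonneg hN0.le, Real.norm_eq_abs]
    calc (N : ℝ) * _ ≤ N * (((N.choose 2 : ℝ) / (N : ℝ) ^ 3) ^ 2 *
          (N * ∫ p in cell (N ^ 3), ‖charFn (N ^ 3) p‖ ^ (N - 4))) := by
            gcongr
            exact abs_normalizedCount_sub_le h2
      _ ≤ N * (((N.choose 2 : ℝ) / (N : ℝ) ^ 3) ^ 2 * C) := by gcongr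
      _ = _ := by field_simp
  have h := (hd.add tendsto_integral_re_charFn_pow).sub
    (hc.mul tendsto_mul_integral_charFn_two_smul)
  rw [show 0 + 3 * π * √15 * (-(472 / 735)) - 1 / 2 * (3 * π * √15) =
    3 * π * √15 * (-(472 / 735) - 1 / 2) by ring] at h
  refine h.congr fun N => ?_
  ring

theorem normalizedCount_mul_stirling {N : ℕ} (hN : N ≠ 0) :
    π ^ (3 / 2 : ℝ) / (6 * √30) * (N : ℝ) ^ (21 / 2 : ℝ) *
        (((N : ℝ) ^ 2 * Real.exp 1) ^ N)⁻¹ * (bimagicCubeSeries N : ℝ) =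
      normalizedCount N / (3 * π * √15) *
        (√(2 * π * N) * (N / Real.exp 1) ^ N / (N.factorial : ℝ)) := by
  have hN0 : (0 : ℝ) < N := by exact_mod_cast Nat.pos_of_ne_zero hN
  have h1 : π ^ (3 / 2 : ℝ) = π * √π := by
    rw [show (3 / 2 : ℝ) = 1 + 1 / 2 by norm_num, Real.rpow_add Real.pi_pos, Real.rpow_one,
      Real.sqrt_eq_rpow]
  have h2 : (N : ℝ) ^ (21 / 2 : ℝ) = (N : ℝ) ^ 10 * √N := by
    rw [show (21 / 2 : ℝ) = (10 : ℕ) + 1 / 2 by norm_num, Real.rpow_add hN0, Real.rpow_natCast,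
      Real.sqrt_eq_rpow]
  have h3 : √30 = √2 * √15 := by
    rw [← Real.sqrt_mul (by norm_num)]
    norm_num
  have h4 : √(2 * π * N) = √2 * √π * √N := by
    rw [Real.sqrt_mul (by positivity), Real.sqrt_mul (by positivity)]
  have h5 : √2 ^ 2 = (2 : ℝ) := Real.sq_sqrt (by norm_num)
  have hf : (N.factorial : ℝ) ≠ 0 := by exact_mod_cast N.factorial_ne_zero
  have hs : √2 ≠ 0 := by positivity
  have he := (Real.exp_pos 1).ne'
  rw [normalizedCount, h1, h2, h3, h4, Nat.cast_mul, mul_pow, div_pow, ← pow_mul, ← pow_mul]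
  have e : (N : ℝ) ^ (3 * N) = N ^ (2 * N) * N ^ N := by
    rw [← pow_add]
    congr 1
    ring
  rw [e]
  have hx : (N : ℝ) ^ N ≠ 0 := by positivity
  have hy : (N : ℝ) ^ (2 * N) ≠ 0 := by positivity
  have hz : (√15 : ℝ) ≠ 0 := by positivity
  generalize √(N : ℝ) = s at *
  generalize (N : ℝ) ^ N = X at *
  generalize (N : ℝ) ^ (2 * N) = Y at *
  generalize (N.factorial : ℝ) = F at *
  generalize Real.exp 1 ^ N = G at *
  field_simp
  rw [h5]
  ring

theorem tendsto_nat_mul_mul_sub_one {y s : ℕ → ℝ} {a b : ℝ}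
    (hy : Tendsto (fun n : ℕ => (n : ℝ) * (y n - 1)) atTop (𝓝 a))
    (hs : Tendsto (fun n : ℕ => (n : ℝ) * (s n - 1)) atTop (𝓝 b)) :
    Tendsto (fun n : ℕ => (n : ℝ) * (y n * s n - 1)) atTop (𝓝 (a + b)) := by
  have hinv := tendsto_inv_atTop_nhds_zero_nat (𝕜 := ℝ)
  have h := (hy.add ((hy.mul hs).mul hinv)).add hs
  rw [mul_zero, add_zero] at h
  refine h.congr' ?_
  filter_upwards [eventually_ne_atTop 0] with n hn
  have hn0 : (n : ℝ) ≠ 0 := by exact_mod_cast hn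
  field_simp
  ring

end BimagicCube

/-- First-order asymptotic expansion for the number of bimagic cube series:
`𝒩₃⁽²⁾(N) = (6√30/π^{3/2}) (N²e)^N / N^{21/2} (1 - 1201/(980N) + o(1/N))`, stated as
`(π^{3/2}/(6√30)) N^{21/2} (N²e)^{-N} 𝒩₃⁽²⁾(N) - (1 - 1201/(980N)) = o(1/N)`. -/
theorem bimagic_cube_series_asymptotics :
    (fun N : ℕ =>
        Real.pi ^ (3 / 2 : ℝ) / (6 * Real.sqrt 30) *
            (N : ℝ) ^ (21 / 2 : ℝ) * (((N : ℝ) ^ 2 * Real.exp 1) ^ N)⁻¹ *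
            (bimagicCubeSeries N : ℝ) -
          (1 - 1201 / (980 * (N : ℝ))))
      =o[atTop] fun N : ℕ => 1 / (N : ℝ) := by
  have hL : (3 * Real.pi * Real.sqrt 15 : ℝ) ≠ 0 := by positivity
  have hy := BimagicCube.tendsto_normalizedCount.div_const (3 * Real.pi * Real.sqrt 15)
  rw [mul_div_cancel_left₀ _ hL] at hy
  have h := ((BimagicCube.tendsto_nat_mul_mul_sub_one
    (hy.congr fun N => show _ = (N : ℝ) *
      (BimagicCube.normalizedCount N / (3 * Real.pi * Real.sqrt 15) - 1) by field_simp) BimagicCube.tendsto_stirling_ratio).add_const (1201 / 980))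
  norm_num only at h
  rw [isLittleO_iff_tendsto']
  · refine h.congr' ?_
    filter_upwards [eventually_ne_atTop 0] with N hN
    have hN0 : (N : ℝ) ≠ 0 := by exact_mod_cast hN
    rw [BimagicCube.normalizedCount_mul_stirling hN]
    field_simp
    ring
  · filter_upwards [eventually_ne_atTop 0] with N hN h0
    have hN0 : (N : ℝ) ≠ 0 := by exact_mod_cast hN
    exact absurd h0 (one_div_ne_zero hN0)
end

section
/- Let N be a positive integer with N ≡ 2 (mod 4). Then there is no subset S of {1,…,N²} with |S| = N, Σ_{i∈S} i = N(N²+1)/2, Σ_{i∈S} i² = N(N²+1)(2N²+1)/6, and Σ_{i∈S} i³ = N³(N²+1)²/4; that is, there are no trimagic square series of order N. -/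
/-- There are no trimagic square series of order `N` when `N ≡ 2 (mod 4)`: no subset
`S` of `{1,…,N²}` has `|S| = N`, `Σ_{i∈S} i = N(N²+1)/2`,
`Σ_{i∈S} i² = N(N²+1)(2N²+1)/6`, and `Σ_{i∈S} i³ = N³(N²+1)²/4`. -/
theorem no_trimagic_series_two_mod_four (N : ℕ) (hN : 0 < N) (hmod : N % 4 = 2) :
    ¬ ∃ S : Finset ℕ, S ⊆ Finset.Icc 1 (N ^ 2) ∧ S.card = N ∧
      (∑ i ∈ S, i = N * (N ^ 2 + 1) / 2) ∧
      (∑ i ∈ S, i ^ 2 = N * (N ^ 2 + 1) * (2 * N ^ 2 + 1) / 6) ∧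
      (∑ i ∈ S, i ^ 3 = N ^ 3 * (N ^ 2 + 1) ^ 2 / 4) := by
  rintro ⟨S, -, -, h₁, -, h₃⟩
  obtain ⟨m, rfl⟩ : ∃ m, N = 2 * m := ⟨N / 2, by omega⟩
  have hm : Odd m := Nat.odd_iff.mpr (by omega)
  have e₁ : 2 * m * ((2 * m) ^ 2 + 1) / 2 = m * (2 * (2 * m ^ 2) + 1) :=
    Nat.div_eq_of_eq_mul_left two_pos (by ring)
  have e₃ : (2 * m) ^ 3 * ((2 * m) ^ 2 + 1) ^ 2 / 4 = 2 * (m ^ 3 * ((2 * m) ^ 2 + 1) ^ 2) :=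
    Nat.div_eq_of_eq_mul_left four_pos (by ring)
  have odd_sum : Odd (∑ i ∈ S, i) := by
    rw [h₁, e₁]
    exact hm.mul ⟨2 * m ^ 2, rfl⟩
  have even_sum_cubes : Even (∑ i ∈ S, i ^ 3) := by
    rw [h₃, e₃]
    exact even_two_mul _
  have same_parity : Even (∑ i ∈ S, (i + i ^ 3)) :=
    Finset.even_sum (fun i => i + i ^ 3) fun i _ => by simp [Nat.even_add, Nat.even_pow]
  rw [Finset.sum_add_distrib, Nat.even_add] at same_parity
  exact Nat.not_even_iff_odd.mpr odd_sum (same_parity.mpr even_sum_cubes)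
end
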